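/- arXiv:2103.07273 — 2 statements merged into one kernel-verified Lean document; each statement's English description precedes it below -/
import Mathlib

section
/- Under the standing assumptions, the spherical average process (h_r(0))_{r ∈ (0,1)} around the origin is a Gaussian process: for every finite collection r₁, …, r_k ∈ (0, 1) and reals λ₁, …, λ_k, the random variable Σᵢ λᵢ h_{rᵢ}(0) is a (possibly degenerate) centered Gaussian random variable. -/
open MeasureTheory ProbabilityTheory Metric Filter Topology Set

noncomputable section

abbrev Euc (d : ℕ) : Type := EuclideanSpace ℝ (Fin d)

/-- The scaling function `s`: `s(r) = -log r` if `d = 2`, and `s(r) = r^(2-d)` if `d ≥ 3`. -/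
noncomputable def sFun (d : ℕ) (r : ℝ) : ℝ :=
  if d = 2 then -Real.log r else r ^ ((2 : ℝ) - (d : ℝ))

open Classical in
/-- The zero boundary Green's function of the open unit ball in `ℝ^d`:
`G(x,y) = s(|x-y|) - s(|x|·|y - x/|x|²|)`, interpreted by continuity at `x = 0`. -/
noncomputable def greenBall (d : ℕ) (x y : Euc d) : ℝ :=
  if x = 0 then sFun d ‖y‖ - sFun d 1
  else sFun d ‖x - y‖ - sFun d (‖x‖ * ‖y - (‖x‖ ^ 2)⁻¹ • x‖)

/-- Smooth compactly supported test functions. -/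
def IsTestFun {d : ℕ} (f : Euc d → ℝ) : Prop :=
  ContDiff ℝ (⊤ : ℕ∞) f ∧ HasCompactSupport f

/-- The Laplacian of `u : ℝ^d → ℝ` at `x`, as the sum of pure second derivatives in the
coordinate directions. -/
noncomputable def lap {d : ℕ} (u : Euc d → ℝ) (x : Euc d) : ℝ :=
  ∑ i : Fin d, iteratedFDeriv ℝ 2 u x ![EuclideanSpace.single i 1, EuclideanSpace.single i 1]

/-- A function is harmonic on a set if it is twice continuously differentiable there with
vanishing Laplacian. -/
def IsHarmonicOn {d : ℕ} (u : Euc d → ℝ) (s : Set (Euc d)) : Prop :=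
  ContDiffOn ℝ 2 u s ∧ ∀ x ∈ s, lap u x = 0

/-- A real random variable is a (possibly degenerate) centered Gaussian. -/
def IsCenteredGaussianRV {Ω : Type} [MeasurableSpace Ω] (P : Measure Ω) (Y : Ω → ℝ) : Prop :=
  ∃ v : NNReal, Measure.map Y P = ProbabilityTheory.gaussianReal 0 v

/-- The standing assumptions: a collection of stochastic processes `h a r` (thought of as
`h^{a + r𝔹}`) indexed by test functions, which is centered, a.s. linear, zero outside the ball,
translation/scaling covariant, satisfies the domain Markov property (with the decomposition
recorded as data `H`, `Φ`, `φharm`), has fourth moments, a (sequentially) continuous covariance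
bilinear form on `C_c^∞(𝔹)`, and zero boundary conditions. -/
structure GFF (d : ℕ) (Ω : Type) [MeasurableSpace Ω] where
  P : Measure Ω
  prob : IsProbabilityMeasure P
  /-- the field `h^{a+r𝔹}` tested against `f` -/
  h : Euc d → ℝ → (Euc d → ℝ) → Ω → ℝ
  meas_h : ∀ a r f, Measurable (h a r f)
  integrable_h : ∀ a r f, IsTestFun f → Integrable (h a r f) P
  /-- centered -/
  centered : ∀ a r f, IsTestFun f → ∫ ω, h a r f ω ∂P = 0
  /-- (1) a.s. linearity in the test function -/
  lin_add : ∀ f g : Euc d → ℝ, IsTestFun f → IsTestFun g →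
    ∀ᵐ ω ∂P, h 0 1 (f + g) ω = h 0 1 f ω + h 0 1 g ω
  lin_smul : ∀ (c : ℝ) (f : Euc d → ℝ), IsTestFun f →
    ∀ᵐ ω ∂P, h 0 1 (c • f) ω = c * h 0 1 f ω
  /-- (2) the field vanishes on test functions supported outside the ball -/
  zero_outside : ∀ f : Euc d → ℝ, IsTestFun f → tsupport f ⊆ (ball (0 : Euc d) 1)ᶜ →
    ∀ᵐ ω ∂P, h 0 1 f ω = 0
  /-- (3) translation and scaling: `(h^{a+r𝔹}, f((·-a)/r)) = r^{1+d/2} (h^𝔹, f)` in law,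
  as processes (equality of finite dimensional distributions) -/
  scaling : ∀ (a : Euc d) (r : ℝ), 0 < r → ∀ (k : ℕ) (f : Fin k → Euc d → ℝ),
    (∀ i, IsTestFun (f i)) →
    Measure.map (fun ω (i : Fin k) => h a r (fun x => f i (r⁻¹ • (x - a))) ω) P
      = Measure.map (fun ω (i : Fin k) => r ^ (1 + (d : ℝ) / 2) * h 0 1 (f i) ω) P
  /-- (4) domain Markov property: the decomposition data. `H a r` is the independent copy of
  `h^{a+r𝔹}`, `Φ a r` is the harmonic part as a process, `φharm a r ω` is the harmonic function. -/
  H : Euc d → ℝ → (Euc d → ℝ) → Ω → ℝ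
  Φ : Euc d → ℝ → (Euc d → ℝ) → Ω → ℝ
  φharm : Euc d → ℝ → Ω → Euc d → ℝ
  meas_H : ∀ a r f, Measurable (H a r f)
  meas_Φ : ∀ a r f, Measurable (Φ a r f)
  meas_φharm : ∀ a r z, Measurable fun ω => φharm a r ω z
  dmp_decomp : ∀ (a : Euc d) (r : ℝ), 0 < r → ball a r ⊆ ball (0 : Euc d) 1 →
    ∀ f : Euc d → ℝ, IsTestFun f → ∀ᵐ ω ∂P, h 0 1 f ω = H a r f ω + Φ a r f ω
  dmp_indep : ∀ (a : Euc d) (r : ℝ), 0 < r → ball a r ⊆ ball (0 : Euc d) 1 →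
    ProbabilityTheory.Indep
      (⨆ f : {f : Euc d → ℝ // IsTestFun f}, MeasurableSpace.comap (H a r f.1) inferInstance)
      ((⨆ f : {f : Euc d → ℝ // IsTestFun f}, MeasurableSpace.comap (Φ a r f.1) inferInstance) ⊔
        (⨆ z : Euc d, MeasurableSpace.comap (fun ω => φharm a r ω z) inferInstance)) P
  dmp_law : ∀ (a : Euc d) (r : ℝ), 0 < r → ball a r ⊆ ball (0 : Euc d) 1 →
    ∀ (k : ℕ) (f : Fin k → Euc d → ℝ), (∀ i, IsTestFun (f i)) →
    Measure.map (fun ω (i : Fin k) => H a r (f i) ω) P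
      = Measure.map (fun ω (i : Fin k) => h a r (f i) ω) P
  dmp_harm : ∀ (a : Euc d) (r : ℝ), 0 < r → ball a r ⊆ ball (0 : Euc d) 1 →
    ∀ᵐ ω ∂P, IsHarmonicOn (φharm a r ω) (ball a r) ∧
      ∀ f : Euc d → ℝ, IsTestFun f → tsupport f ⊆ ball a r →
        Φ a r f ω = ∫ x in ball a r, φharm a r ω x * f x
  /-- (5) fourth moments -/
  mom4 : ∀ f : Euc d → ℝ, IsTestFun f → Integrable (fun ω => (h 0 1 f ω) ^ 4) P
  /-- (6) sequential continuity of the covariance bilinear form on `C_c^∞(𝔹)` -/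
  K2_cont : ∀ (f : ℕ → Euc d → ℝ) (f₀ g : Euc d → ℝ) (K : Set (Euc d)),
    IsCompact K → K ⊆ ball (0 : Euc d) 1 →
    (∀ n, IsTestFun (f n)) → IsTestFun f₀ → IsTestFun g → tsupport g ⊆ ball (0 : Euc d) 1 →
    (∀ n, tsupport (f n) ⊆ K) → tsupport f₀ ⊆ K →
    (∀ m : ℕ, TendstoUniformly (fun n => iteratedFDeriv ℝ m (f n)) (iteratedFDeriv ℝ m f₀) atTop) →
    Tendsto (fun n => ∫ ω, h 0 1 (f n) ω * h 0 1 g ω ∂P) atTop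
      (𝓝 (∫ ω, h 0 1 f₀ ω * h 0 1 g ω ∂P))
  /-- (7) zero boundary conditions -/
  zero_bdry : ∀ f : ℕ → Euc d → ℝ,
    (∀ n, IsTestFun (f n)) → (∀ n x, 0 ≤ f n x) →
    (∃ C : ℝ, ∀ n, ∫ x, f n x ≤ C) →
    Tendsto (fun n => Metric.infDist (0 : Euc d) (tsupport (f n))) atTop (𝓝 1) →
    (∃ C : ℝ, ∀ (n : ℕ) (x y : Euc d), ‖x‖ = ‖y‖ → ‖x‖ < 1 → f n x ≤ C * f n y) →
    Tendsto (fun n => ∫ ω, (h 0 1 (f n) ω) ^ 2 ∂P) atTop (𝓝 0)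

instance {d : ℕ} {Ω : Type} [MeasurableSpace Ω] (X : GFF d Ω) : IsProbabilityMeasure X.P :=
  X.prob

/-- The spherical average `h_ε(z) = φ^{z+ε𝔹}_𝔹(z)`. -/
noncomputable def GFF.sphAvg {d : ℕ} {Ω : Type} [MeasurableSpace Ω] (X : GFF d Ω) (z : Euc d) (ε : ℝ) (ω : Ω) : ℝ :=
  X.φharm z ε ω z


theorem eq_exp_of_logDeriv_linear {φ : ℝ → ℂ} (hφ : Differentiable ℝ φ) (h0 : φ 0 = 1)
    {v δ : ℝ} (hδ : ∀ t, |t| < δ → deriv φ t = -(v * t) * φ t) {t : ℝ} (ht : |t| < δ) :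
    φ t = Complex.exp (-(v * t ^ 2 / 2)) := by
  set F : ℝ → ℂ := fun t => φ t * Complex.exp ((v * t ^ 2 / 2 : ℂ)) with hF
  have hE : ∀ s : ℝ, HasDerivAt (fun t : ℝ => Complex.exp ((v * (t : ℂ) ^ 2 / 2 : ℂ)))
      (Complex.exp (v * (s : ℂ) ^ 2 / 2) * (v * s)) s := fun s => by
    have h1 : HasDerivAt (fun t : ℂ => v * t ^ 2 / 2) (v * s : ℂ) (s : ℂ) := by
      have := ((hasDerivAt_pow 2 (s : ℂ)).const_mul (v : ℂ)).div_const 2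
      refine this.congr_deriv ?_
      simp; ring
    exact (h1.cexp).comp_ofReal
  have hd : ∀ s : ℝ, HasDerivAt F
      (deriv φ s * Complex.exp (v * (s : ℂ) ^ 2 / 2)
        + φ s * (Complex.exp (v * (s : ℂ) ^ 2 / 2) * (v * s))) s := fun s =>
    (hφ s).hasDerivAt.mul (hE s)
  have hball : ∀ s ∈ ball (0 : ℝ) δ, |s| < δ := fun s hs => by simpa using hs
  have hconst : F t = F 0 := by
    have hc := (convex_ball (0 : ℝ) δ).is_const_of_fderivWithin_eq_zero (𝕜 := ℝ) (f := F)
      (fun s _ => (hd s).differentiableAt.differentiableWithinAt) ?_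
      (x := t) (y := 0) (by simpa using ht) (by simpa using (abs_nonneg t).trans_lt ht)
    · exact hc
    · intro s hs
      rw [fderivWithin_of_isOpen isOpen_ball hs]
      have := (hd s).hasFDerivAt.fderiv
      rw [this, hδ s (hball s hs)]
      ext
      simp
      ring
  have h1 : φ t * Complex.exp ((v * (t : ℂ) ^ 2 / 2 : ℂ)) = 1 := by
    have : F 0 = 1 := by simp [hF, h0]
    rw [← this, ← hconst]
  rw [Complex.exp_neg]
  exact eq_inv_of_mul_eq_one_left h1

/-- A function satisfying the duplication rule of Gaussian characteristic functions is one. -/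
theorem eq_exp_of_duplication {φ : ℝ → ℂ} (hφ : ContDiff ℝ 2 φ) (h0 : φ 0 = 1)
    (h1 : deriv φ 0 = 0) {v : ℝ} (h2 : deriv (deriv φ) 0 = -v)
    (hdup : ∀ α, deriv φ (2 * α) * φ α ^ 2 = 2 * deriv φ α * φ (2 * α) * φ α) (t : ℝ) :
    φ t = Complex.exp (-(v * t ^ 2 / 2)) := by
  have hdiff : Differentiable ℝ φ := hφ.differentiable (by norm_num)
  have hdiff' : Differentiable ℝ (deriv φ) := by
    have : ContDiff ℝ (1 + 1) φ := hφ
    exact (contDiff_succ_iff_deriv.1 this).2.2.differentiable (by norm_num)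
  have hne : ∀ᶠ t in 𝓝 (0 : ℝ), φ t ≠ 0 :=
    hdiff.continuous.continuousAt.eventually_ne (by simp [h0])
  obtain ⟨δ, hδ, hball⟩ := Metric.eventually_nhds_iff.1 hne
  have hball : ∀ t, |t| < δ → φ t ≠ 0 := fun t ht => hball (by simpa using ht)
  have hdup' : ∀ α, φ α ≠ 0 → deriv φ (2 * α) * φ α = 2 * deriv φ α * φ (2 * α) := by
    intro α hα
    have := hdup α
    apply mul_right_cancel₀ hα
    linear_combination this
  have hbase : ∀ t, |t| < δ → deriv φ t = -(v * t) * φ t := by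
    intro t ht
    set ψ : ℝ → ℂ := fun t => deriv φ t / φ t with hψ
    have hψ0 : HasDerivAt ψ (-v) 0 := by
      have := (hdiff' 0).hasDerivAt.div (hdiff 0).hasDerivAt (by simp [h0])
      refine this.congr_deriv ?_
      simp [h0, h1, h2]
    have habs : ∀ n : ℕ, |t / 2 ^ n| < δ := fun n => by
      rw [abs_div, abs_of_pos (by positivity : (0 : ℝ) < 2 ^ n)]
      exact (div_le_self (abs_nonneg t) (one_le_pow₀ (by norm_num))).trans_lt ht
    have hrec : ∀ n : ℕ, ψ t = 2 ^ n * ψ (t / 2 ^ n) := by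
      intro n
      induction n with
      | zero => simp
      | succ n ih =>
        have ha := hball _ (habs n)
        have hb := hball _ (habs (n + 1))
        have hh := hdup' _ hb
        have he : 2 * (t / 2 ^ (n + 1)) = t / 2 ^ n := by rw [pow_succ]; field_simp
        rw [he] at hh
        rw [ih, hψ]
        simp only
        rw [pow_succ, mul_assoc]
        congr 1
        field_simp
        linear_combination hh
    have hlim : Tendsto (fun n : ℕ => (2 : ℂ) ^ n * ψ (t / 2 ^ n)) atTop (𝓝 (-(v * t))) := by
      by_cases ht0 : t = 0
      · simp [ht0, hψ, h1]
      have hs := hψ0.tendsto_slope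
      have hseq : Tendsto (fun n : ℕ => t / 2 ^ n) atTop (𝓝[≠] (0 : ℝ)) := by
        refine tendsto_nhdsWithin_iff.2 ⟨?_, Eventually.of_forall fun n => ?_⟩
        · have := (tendsto_pow_atTop_nhds_zero_of_lt_one (r := (1 / 2 : ℝ))
            (by norm_num) (by norm_num)).const_mul t
          simpa [div_eq_mul_inv] using this
        · simp [ht0]
      have := (hs.comp hseq).const_mul (t : ℂ)
      have e : (t : ℂ) * -v = -(v * t) := by ring
      rw [e] at this
      refine this.congr fun n => ?_
      have ht0' : (t : ℂ) ≠ 0 := by exact_mod_cast ht0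
      simp [slope_def_module, hψ, h1]
      field_simp
    have : ψ t = -(v * t) :=
      tendsto_nhds_unique (tendsto_const_nhds.congr hrec) hlim
    rw [← this, hψ]
    simp only
    rw [div_mul_cancel₀ _ (hball t ht)]
  have hall : ∀ n : ℕ, ∀ t, |t| < 2 ^ n * δ → deriv φ t = -(v * t) * φ t := by
    intro n
    induction n with
    | zero => simpa using hbase
    | succ n ih =>
      intro t ht
      have ht2 : |t / 2| < 2 ^ n * δ := by
        rw [abs_div, abs_two]; rw [pow_succ] at ht; linarith
      have hexp := eq_exp_of_logDeriv_linear hdiff h0 ih ht2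
      have hnz : φ (t / 2) ≠ 0 := by rw [hexp]; exact Complex.exp_ne_zero _
      have := hdup' _ hnz
      rw [ih _ ht2, mul_div_cancel₀ t two_ne_zero] at this
      apply mul_right_cancel₀ hnz
      rw [this]; push_cast; ring
  obtain ⟨n, hn⟩ := pow_unbounded_of_one_lt (|t| / δ) (by norm_num : (1 : ℝ) < 2)
  exact eq_exp_of_logDeriv_linear hdiff h0 (hall n) (by rwa [div_lt_iff₀ hδ] at hn)

/-- A centered square integrable real random variable whose characteristic function satisfies the
duplication rule is Gaussian. -/
theorem map_eq_gaussianReal_of_duplication {Ω : Type*} [MeasurableSpace Ω] {P : Measure Ω}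
    [IsProbabilityMeasure P] {Z : Ω → ℝ} (hZ : Measurable Z) (hZ2 : MemLp Z 2 P)
    (hZ0 : ∫ ω, Z ω ∂P = 0)
    (hdup : ∀ α : ℝ, (∫ ω, (Z ω : ℂ) * Complex.exp ((2 * α : ℝ) * Z ω * Complex.I) ∂P)
        * (∫ ω, Complex.exp (α * Z ω * Complex.I) ∂P) ^ 2
      = 2 * (∫ ω, (Z ω : ℂ) * Complex.exp (α * Z ω * Complex.I) ∂P)
        * (∫ ω, Complex.exp ((2 * α : ℝ) * Z ω * Complex.I) ∂P)
        * ∫ ω, Complex.exp (α * Z ω * Complex.I) ∂P) :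
    ∃ v : NNReal, P.map Z = gaussianReal 0 v := by
  have hprob : IsProbabilityMeasure (P.map Z) := Measure.isProbabilityMeasure_map hZ.aemeasurable
  have hmem : MemLp id 2 (P.map Z) := (memLp_map_measure_iff (by fun_prop) hZ.aemeasurable).2 hZ2
  have hmem1 : MemLp id ((1 : ℕ) : ENNReal) (P.map Z) := hmem.mono_exponent (by norm_num)
  have hmem2 : MemLp id ((2 : ℕ) : ENNReal) (P.map Z) := hmem
  have hφ : ∀ t : ℝ, charFun (P.map Z) t = ∫ ω, Complex.exp (t * Z ω * Complex.I) ∂P := fun t => by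
    rw [charFun_apply_real, integral_map hZ.aemeasurable (by fun_prop)]
  have hφ' : ∀ t : ℝ, deriv (charFun (P.map Z)) t
      = Complex.I * ∫ ω, (Z ω : ℂ) * Complex.exp (t * Z ω * Complex.I) ∂P := fun t => by
    rw [← iteratedDeriv_one, iteratedDeriv_charFun hmem1,
      integral_map hZ.aemeasurable (by fun_prop)]
    simp
  have hcd : ContDiff ℝ 2 (charFun (P.map Z)) := contDiff_charFun hmem2
  set v : NNReal := ⟨∫ ω, Z ω ^ 2 ∂P, integral_nonneg fun ω => sq_nonneg _⟩ with hv
  refine ⟨v, Measure.ext_of_charFun (funext fun t => ?_)⟩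
  rw [charFun_gaussianReal, eq_exp_of_duplication (v := v) hcd (by simp) ?_ ?_ ?_ t]
  · congr 1; push_cast; ring
  · rw [hφ']
    have : ∫ ω, (Z ω : ℂ) * Complex.exp ((0 : ℝ) * Z ω * Complex.I) ∂P
        = ((∫ ω, Z ω ∂P : ℝ) : ℂ) := by
      rw [← integral_complex_ofReal]; simp
    rw [this, hZ0]; simp
  · have h2 := iteratedDeriv_charFun_zero hmem2
    rw [iteratedDeriv_succ, iteratedDeriv_one, integral_map hZ.aemeasurable (by fun_prop)] at h2
    rw [h2]
    simp [hv]
    rfl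
  · intro α
    rw [hφ', hφ', hφ, hφ]
    linear_combination Complex.I * hdup α

section CharInt

variable {Ω : Type*} {m0 : MeasurableSpace Ω}

/-- The integral of `F` against the character `exp (i G)`. -/
def charInt (P : Measure Ω) (F G : Ω → ℝ) : ℂ :=
  ∫ ω, (F ω : ℂ) * Complex.exp (G ω * Complex.I) ∂P

/-- The numerator of the difference between `E[F exp(i(G₁+G₂))] / E[exp(i(G₁+G₂))]` and
`E[F exp(iG₁)] / E[exp(iG₁)] + E[F exp(iG₂)] / E[exp(iG₂)]`. -/
def charDefect (P : Measure Ω) (F G₁ G₂ : Ω → ℝ) : ℂ :=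
  charInt P F (G₁ + G₂) * charInt P 1 G₁ * charInt P 1 G₂
    - charInt P F G₁ * charInt P 1 (G₁ + G₂) * charInt P 1 G₂
    - charInt P F G₂ * charInt P 1 (G₁ + G₂) * charInt P 1 G₁

variable {P : Measure Ω} {F F' G G' G₁ G₁' G₂ G₂' : Ω → ℝ}

theorem charInt_congr (hF : F =ᵐ[P] F') (hG : G =ᵐ[P] G') : charInt P F G = charInt P F' G' := by
  refine integral_congr_ae ?_
  filter_upwards [hF, hG] with ω h1 h2
  rw [h1, h2]

theorem charDefect_congr (hF : F =ᵐ[P] F') (h₁ : G₁ =ᵐ[P] G₁') (h₂ : G₂ =ᵐ[P] G₂') :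
    charDefect P F G₁ G₂ = charDefect P F' G₁' G₂' := by
  have h₁₂ : G₁ + G₂ =ᵐ[P] G₁' + G₂' := h₁.add h₂
  have h1 : (1 : Ω → ℝ) =ᵐ[P] 1 := EventuallyEq.rfl
  simp only [charDefect, charInt_congr hF h₁₂, charInt_congr h1 h₁, charInt_congr h1 h₂,
    charInt_congr hF h₁, charInt_congr h1 h₁₂, charInt_congr hF h₂]

theorem charDefect_comm : charDefect P F G₁ G₂ = charDefect P F G₂ G₁ := by
  simp only [charDefect, add_comm G₁ G₂]
  ring

theorem integrable_mul_cexp (hF : Integrable F P) (hG : AEMeasurable G P) :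
    Integrable (fun ω => (F ω : ℂ) * Complex.exp (G ω * Complex.I)) P := by
  refine hF.ofReal.mul_bdd (c := 1) ?_ ?_
  · exact (by fun_prop :
      AEMeasurable (fun ω => Complex.exp (G ω * Complex.I)) P).aestronglyMeasurable
  · exact Eventually.of_forall fun ω => by rw [Complex.norm_exp_ofReal_mul_I]

theorem charInt_add (hF : Integrable F P) (hF' : Integrable F' P) (hG : AEMeasurable G P) :
    charInt P (F + F') G = charInt P F G + charInt P F' G := by
  rw [charInt, charInt, charInt,
    ← integral_add (integrable_mul_cexp hF hG) (integrable_mul_cexp hF' hG)]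
  refine integral_congr_ae (Eventually.of_forall fun ω => ?_)
  simp [add_mul]

theorem charInt_smul (c : ℝ) : charInt P (c • F) G = c * charInt P F G := by
  rw [charInt, charInt, ← integral_const_mul]
  refine integral_congr_ae (Eventually.of_forall fun ω => ?_)
  simp [mul_assoc]

theorem charDefect_add (hF : Integrable F P) (hF' : Integrable F' P) (h₁ : AEMeasurable G₁ P)
    (h₂ : AEMeasurable G₂ P) :
    charDefect P (F + F') G₁ G₂ = charDefect P F G₁ G₂ + charDefect P F' G₁ G₂ := by
  simp only [charDefect, charInt_add hF hF' h₁, charInt_add hF hF' h₂,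
    charInt_add hF hF' (h₁.add h₂)]
  ring

theorem charDefect_smul (c : ℝ) : charDefect P (c • F) G₁ G₂ = c * charDefect P F G₁ G₂ := by
  simp only [charDefect, charInt_smul]
  ring

theorem charInt_zero_right : charInt P F 0 = (∫ ω, F ω ∂P : ℝ) := by
  simp only [charInt, Pi.zero_apply, Complex.ofReal_zero, zero_mul, Complex.exp_zero, mul_one]
  exact integral_complex_ofReal

theorem integral_mul_of_indep {m₁ m₂ : MeasurableSpace Ω} (hm₁ : m₁ ≤ m0) (hm₂ : m₂ ≤ m0)
    (hind : Indep m₁ m₂ P) {U V : Ω → ℂ} (hU : Measurable[m₁] U) (hV : Measurable[m₂] V) :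
    ∫ ω, U ω * V ω ∂P = (∫ ω, U ω ∂P) * ∫ ω, V ω ∂P := by
  have hUV : IndepFun U V P := by
    rw [IndepFun_iff_Indep]
    exact indep_of_indep_of_le_left (indep_of_indep_of_le_right hind hV.comap_le) hU.comap_le
  exact hUV.integral_fun_mul_eq_mul_integral (hU.mono hm₁ le_rfl).aestronglyMeasurable
    (hV.mono hm₂ le_rfl).aestronglyMeasurable

theorem charInt_add_of_indep {m₁ m₂ : MeasurableSpace Ω} (hm₁ : m₁ ≤ m0) (hm₂ : m₂ ≤ m0)
    (hind : Indep m₁ m₂ P) (hF : Measurable[m₁] F) (h₁ : Measurable[m₁] G₁)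
    (h₂ : Measurable[m₂] G₂) :
    charInt P F (G₁ + G₂) = charInt P F G₁ * charInt P 1 G₂ := by
  have hU : Measurable[m₁] fun ω => (F ω : ℂ) * Complex.exp (G₁ ω * Complex.I) := by fun_prop
  have hV : Measurable[m₂] fun ω => ((1 : Ω → ℝ) ω : ℂ) * Complex.exp (G₂ ω * Complex.I) := by
    simp only [Pi.one_apply]; fun_prop
  rw [charInt, charInt, charInt, ← integral_mul_of_indep hm₁ hm₂ hind hU hV]
  refine integral_congr_ae (Eventually.of_forall fun ω => ?_)
  simp [add_mul, Complex.exp_add, mul_assoc]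

theorem charDefect_eq_zero_of_indep {m₁ m₂ : MeasurableSpace Ω} (hm₁ : m₁ ≤ m0) (hm₂ : m₂ ≤ m0)
    (hind : Indep m₁ m₂ P) {K H₁ Φ₁ Φ₂ : Ω → ℝ} (hK : Measurable[m₁] K) (hH : Measurable[m₁] H₁)
    (hΦ₁ : Measurable[m₂] Φ₁) (hΦ₂ : Measurable[m₂] Φ₂) (hK0 : ∫ ω, K ω ∂P = 0) :
    charDefect P K (H₁ + Φ₁) Φ₂ = 0 := by
  have h1 : Measurable[m₁] (1 : Ω → ℝ) := @measurable_one _ _ _ m₁ _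
  have hΦ : Measurable[m₂] (Φ₁ + Φ₂) := Measurable.add (m := m₂) hΦ₁ hΦ₂
  have h0 : charInt P K Φ₂ = 0 := by
    have := charInt_add_of_indep hm₁ hm₂ hind hK
      (@measurable_zero _ _ _ m₁ _ : Measurable[m₁] (0 : Ω → ℝ)) hΦ₂
    rw [zero_add] at this
    have h2 : charInt P K 0 = 0 := by
      rw [charInt_zero_right, hK0, Complex.ofReal_zero]
    rw [this, h2, zero_mul]
  rw [charDefect, h0, add_assoc, charInt_add_of_indep hm₁ hm₂ hind hK hH hΦ,
    charInt_add_of_indep hm₁ hm₂ hind hK hH hΦ₁,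
    charInt_add_of_indep hm₁ hm₂ hind h1 hH hΦ,
    charInt_add_of_indep hm₁ hm₂ hind h1 hH hΦ₁]
  ring

variable {ι : Type*} {l : Filter ι} {Fn Gn Gn₁ Gn₂ : ι → Ω → ℝ}

theorem tendsto_charInt [IsProbabilityMeasure P] (hFn : ∀ n, MemLp (Fn n) 2 P) (hF : MemLp F 2 P)
    (hGn : ∀ n, MemLp (Gn n) 2 P) (hG : MemLp G 2 P)
    (hFl : Tendsto (fun n => eLpNorm (Fn n - F) 2 P) l (𝓝 0))
    (hGl : Tendsto (fun n => eLpNorm (Gn n - G) 2 P) l (𝓝 0)) :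
    Tendsto (fun n => charInt P (Fn n) (Gn n)) l (𝓝 (charInt P F G)) := by
  have hInt : ∀ {A B : Ω → ℝ}, MemLp A 2 P → MemLp B 2 P →
      Integrable (fun ω => (A ω : ℂ) * Complex.exp (B ω * Complex.I)) P := fun hA hB =>
    integrable_mul_cexp (hA.integrable (by norm_num)) hB.aestronglyMeasurable.aemeasurable
  refine tendsto_integral_of_L1' _ (hInt hF hG).aestronglyMeasurable
    (Eventually.of_forall fun n => hInt (hFn n) (hGn n)) ?_
  have hbound : ∀ n, eLpNorm ((fun ω => (Fn n ω : ℂ) * Complex.exp (Gn n ω * Complex.I))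
      - fun ω => (F ω : ℂ) * Complex.exp (G ω * Complex.I)) 1 P
      ≤ eLpNorm (Fn n - F) 2 P + eLpNorm F 2 P * eLpNorm (Gn n - G) 2 P := by
    intro n
    have hle : ∀ ω, ‖(Fn n ω : ℂ) * Complex.exp (Gn n ω * Complex.I)
        - (F ω : ℂ) * Complex.exp (G ω * Complex.I)‖
        ≤ |(Fn n - F) ω| + |(F • (Gn n - G)) ω| := by
      intro ω
      have e : (Fn n ω : ℂ) * Complex.exp (Gn n ω * Complex.I)
          - (F ω : ℂ) * Complex.exp (G ω * Complex.I)
          = ((Fn n ω - F ω : ℝ) : ℂ) * Complex.exp (Gn n ω * Complex.I)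
            + (F ω : ℂ) * (Complex.exp (Gn n ω * Complex.I) - Complex.exp (G ω * Complex.I)) := by
        push_cast; ring
      rw [e]
      refine (norm_add_le _ _).trans (add_le_add ?_ ?_)
      · rw [norm_mul, Complex.norm_exp_ofReal_mul_I, mul_one, Complex.norm_real]
        rfl
      · rw [norm_mul, Complex.norm_real]
        simp only [Pi.smul_apply', Pi.sub_apply, smul_eq_mul, abs_mul]
        refine mul_le_mul_of_nonneg_left ?_ (abs_nonneg _)
        have e2 : Complex.exp (Gn n ω * Complex.I) - Complex.exp (G ω * Complex.I)
            = Complex.exp (G ω * Complex.I)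
              * (Complex.exp (Complex.I * ((Gn n ω - G ω : ℝ) : ℂ)) - 1) := by
          rw [mul_sub, ← Complex.exp_add, mul_one]
          congr 2
          push_cast; ring
        rw [e2, norm_mul, Complex.norm_exp_ofReal_mul_I, one_mul]
        exact Real.norm_exp_I_mul_ofReal_sub_one_le
    calc _ ≤ eLpNorm (fun ω => |(Fn n - F) ω| + |(F • (Gn n - G)) ω|) 1 P :=
          eLpNorm_mono_real hle
      _ ≤ eLpNorm (fun ω => |(Fn n - F) ω|) 1 P + eLpNorm (fun ω => |(F • (Gn n - G)) ω|) 1 P := by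
          refine eLpNorm_add_le ?_ ?_ le_rfl
          · exact ((hFn n).sub hF).aestronglyMeasurable.norm
          · exact (hF.aestronglyMeasurable.smul ((hGn n).sub hG).aestronglyMeasurable).norm
      _ = eLpNorm (Fn n - F) 1 P + eLpNorm (F • (Gn n - G)) 1 P := by
          congr 1
          · exact eLpNorm_norm (Fn n - F)
          · exact eLpNorm_norm (F • (Gn n - G))
      _ ≤ _ := by
          refine add_le_add ?_ ?_
          · exact eLpNorm_le_eLpNorm_of_exponent_le (by norm_num)
              ((hFn n).sub hF).aestronglyMeasurable
          · exact eLpNorm_smul_le_mul_eLpNorm ((hGn n).sub hG).aestronglyMeasurable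
              hF.aestronglyMeasurable
  refine tendsto_of_tendsto_of_tendsto_of_le_of_le tendsto_const_nhds ?_ (fun n => zero_le) hbound
  have := hFl.add (ENNReal.Tendsto.const_mul hGl (Or.inr hF.eLpNorm_ne_top))
  simpa using this

theorem tendsto_eLpNorm_add {p : ENNReal} (hp : 1 ≤ p) (hGn₁ : ∀ n, MemLp (Gn₁ n) p P)
    (hGn₂ : ∀ n, MemLp (Gn₂ n) p P) (hG₁ : MemLp G₁ p P) (hG₂ : MemLp G₂ p P)
    (h₁ : Tendsto (fun n => eLpNorm (Gn₁ n - G₁) p P) l (𝓝 0))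
    (h₂ : Tendsto (fun n => eLpNorm (Gn₂ n - G₂) p P) l (𝓝 0)) :
    Tendsto (fun n => eLpNorm (Gn₁ n + Gn₂ n - (G₁ + G₂)) p P) l (𝓝 0) := by
  have := h₁.add h₂
  rw [add_zero] at this
  refine tendsto_of_tendsto_of_tendsto_of_le_of_le tendsto_const_nhds this (fun n => zero_le)
    fun n => ?_
  have e : Gn₁ n + Gn₂ n - (G₁ + G₂) = (Gn₁ n - G₁) + (Gn₂ n - G₂) := by abel
  simp only [e]
  exact eLpNorm_add_le ((hGn₁ n).sub hG₁).aestronglyMeasurable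
    ((hGn₂ n).sub hG₂).aestronglyMeasurable hp

theorem tendsto_charDefect [IsProbabilityMeasure P] (hFn : ∀ n, MemLp (Fn n) 2 P) (hF : MemLp F 2 P)
    (hGn₁ : ∀ n, MemLp (Gn₁ n) 2 P) (hG₁ : MemLp G₁ 2 P)
    (hGn₂ : ∀ n, MemLp (Gn₂ n) 2 P) (hG₂ : MemLp G₂ 2 P)
    (hFl : Tendsto (fun n => eLpNorm (Fn n - F) 2 P) l (𝓝 0))
    (h₁ : Tendsto (fun n => eLpNorm (Gn₁ n - G₁) 2 P) l (𝓝 0))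
    (h₂ : Tendsto (fun n => eLpNorm (Gn₂ n - G₂) 2 P) l (𝓝 0)) :
    Tendsto (fun n => charDefect P (Fn n) (Gn₁ n) (Gn₂ n)) l (𝓝 (charDefect P F G₁ G₂)) := by
  have h₁₂ := tendsto_eLpNorm_add (by norm_num) hGn₁ hGn₂ hG₁ hG₂ h₁ h₂
  have hGn₁₂ : ∀ n, MemLp (Gn₁ n + Gn₂ n) 2 P := fun n => (hGn₁ n).add (hGn₂ n)
  have hone : MemLp (1 : Ω → ℝ) 2 P := memLp_const 1
  have hone' : ∀ _ : ι, MemLp (1 : Ω → ℝ) 2 P := fun _ => hone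
  have hl1 : Tendsto (fun _ : ι => eLpNorm ((1 : Ω → ℝ) - 1) 2 P) l (𝓝 0) := by
    simp only [sub_self, eLpNorm_zero]
    exact tendsto_const_nhds
  have a := tendsto_charInt hFn hF hGn₁₂ (hG₁.add hG₂) hFl h₁₂
  have b := tendsto_charInt hone' hone hGn₁ hG₁ hl1 h₁
  have c := tendsto_charInt hone' hone hGn₂ hG₂ hl1 h₂
  have d := tendsto_charInt hFn hF hGn₁ hG₁ hFl h₁
  have e := tendsto_charInt hone' hone hGn₁₂ (hG₁.add hG₂) hl1 h₁₂
  have f := tendsto_charInt hFn hF hGn₂ hG₂ hFl h₂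
  exact (((a.mul b).mul c).sub ((d.mul e).mul c)).sub ((f.mul e).mul b)

end CharInt

section Laplacian

variable {d : ℕ}

theorem fderiv_fderiv_apply {u : Euc d → ℝ} {x : Euc d} (hu : ContDiffAt ℝ 2 u x) (v w : Euc d) :
    fderiv ℝ (fun y => fderiv ℝ u y v) x w = fderiv ℝ (fderiv ℝ u) x w v := by
  have h : DifferentiableAt ℝ (fderiv ℝ u) x :=
    (hu.fderiv_right (m := 1) (by norm_num)).differentiableAt (by norm_num)
  rw [(h.hasFDerivAt.clm_apply (hasFDerivAt_const v x)).fderiv]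
  simp

theorem lap_eq_sum_fderiv {u : Euc d → ℝ} {x : Euc d} (hu : ContDiffAt ℝ 2 u x) :
    lap u x = ∑ i : Fin d, fderiv ℝ (fun y => fderiv ℝ u y (EuclideanSpace.single i 1)) x
      (EuclideanSpace.single i 1) := by
  simp only [lap, iteratedFDeriv_two_apply, fderiv_fderiv_apply hu]
  rfl

theorem lap_sum {ι : Type*} (s : Finset ι) {ψ : ι → Euc d → ℝ} (hψ : ∀ i ∈ s, IsTestFun (ψ i)) :
    lap (∑ i ∈ s, ψ i) = ∑ i ∈ s, lap (ψ i) := by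
  ext x
  have h : iteratedFDeriv ℝ 2 (∑ i ∈ s, ψ i) x = ∑ i ∈ s, iteratedFDeriv ℝ 2 (ψ i) x := by
    have := congrFun (iteratedFDeriv_sum (𝕜 := ℝ) (f := ψ) (u := s) (i := 2)
      fun j hj => (hψ j hj).1.of_le (WithTop.coe_le_coe.2 (le_top : (2 : ℕ∞) ≤ ⊤))) x
    rw [Finset.sum_fn]
    simpa using this
  simp only [lap, h, Finset.sum_apply, _root_.sum_apply]
  rw [Finset.sum_comm]

theorem IsTestFun.contDiff_two {ψ : Euc d → ℝ} (hψ : IsTestFun ψ) : ContDiff ℝ 2 ψ :=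
  hψ.1.of_le (WithTop.coe_le_coe.2 (le_top : (2 : ℕ∞) ≤ ⊤))

theorem tsupport_lap_subset (ψ : Euc d → ℝ) : tsupport (lap ψ) ⊆ tsupport ψ := by
  refine closure_minimal (fun x hx => ?_) (isClosed_tsupport ψ)
  by_contra h
  have h0 : iteratedFDeriv ℝ 2 ψ x = 0 := by
    have := support_iteratedFDeriv_subset (𝕜 := ℝ) (f := ψ) 2
    exact Function.notMem_support.1 fun h' => h (this h')
  exact hx (by simp [lap, h0])

theorem IsTestFun.contDiff_fderiv_apply {ψ : Euc d → ℝ} (hψ : IsTestFun ψ) (v : Euc d) :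
    ContDiff ℝ (⊤ : ℕ∞) fun y => fderiv ℝ ψ y v :=
  (hψ.1.fderiv_right (m := (⊤ : ℕ∞)) (by simp)).clm_apply contDiff_const

theorem IsTestFun.fderiv_apply {ψ : Euc d → ℝ} (hψ : IsTestFun ψ) (v : Euc d) :
    IsTestFun fun y => fderiv ℝ ψ y v :=
  ⟨hψ.contDiff_fderiv_apply v, hψ.2.fderiv_apply (𝕜 := ℝ) v⟩

theorem IsTestFun.lap {ψ : Euc d → ℝ} (hψ : IsTestFun ψ) : IsTestFun (lap ψ) := by
  refine ⟨?_, hψ.2.mono' ((subset_tsupport _).trans (tsupport_lap_subset ψ))⟩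
  have : _root_.lap ψ = fun x => ∑ i : Fin d,
      fderiv ℝ (fun y => fderiv ℝ ψ y (EuclideanSpace.single i 1)) x (EuclideanSpace.single i 1) :=
    funext fun x => lap_eq_sum_fderiv hψ.contDiff_two.contDiffAt
  rw [this]
  exact ContDiff.sum fun i _ => ((hψ.fderiv_apply _).fderiv_apply _).1

theorem integrable_mul_of_tsupport_subset {D : Set (Euc d)} (hD : IsOpen D) {u f : Euc d → ℝ}
    (hu : ContinuousOn u D) (hf : Continuous f) (hfc : HasCompactSupport f)
    (hfD : tsupport f ⊆ D) : Integrable fun x => u x * f x := by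
  refine Continuous.integrable_of_hasCompactSupport ?_ hfc.mul_left
  refine continuous_of_tsupport fun x hx => ?_
  have hxf : x ∈ tsupport f := tsupport_mul_subset_right (f := u) (g := f) hx
  exact (hu.continuousAt (hD.mem_nhds (hfD hxf))).mul hf.continuousAt

/-- Harmonic functions integrate to zero against Laplacians of test functions. -/
theorem integral_harmonic_mul_lap {D : Set (Euc d)} (hD : IsOpen D) {u ψ : Euc d → ℝ}
    (hu : IsHarmonicOn u D) (hψ : IsTestFun ψ) (hψD : tsupport ψ ⊆ D) :
    ∫ x, u x * lap ψ x = 0 := by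
  have huat : ∀ x ∈ D, ContDiffAt ℝ 2 u x := fun x hx => hu.1.contDiffAt (hD.mem_nhds hx)
  have hcont : ContinuousOn u D := hu.1.continuousOn
  have hdiff : ∀ x ∈ D, DifferentiableAt ℝ u x := fun x hx =>
    (huat x hx).differentiableAt (by norm_num)
  have hu1 : ∀ v, ∀ x ∈ D, ContDiffAt ℝ 1 (fun y => fderiv ℝ u y v) x := fun v x hx =>
    ((huat x hx).fderiv_right (m := 1) (by norm_num)).clm_apply contDiffAt_const
  have hcont1 : ∀ v, ContinuousOn (fun y => fderiv ℝ u y v) D := fun v x hx =>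
    (hu1 v x hx).continuousAt.continuousWithinAt
  have hcont2 : ∀ v, ContinuousOn (fun x => fderiv ℝ (fun y => fderiv ℝ u y v) x v) D :=
    fun v x hx => ((((hu1 v x hx).fderiv_right (m := 0) (by norm_num)).clm_apply
      contDiffAt_const).continuousAt).continuousWithinAt
  have hts : ∀ v, tsupport (fun y => fderiv ℝ ψ y v) ⊆ D := fun v =>
    (tsupport_fderiv_apply_subset ℝ v).trans hψD
  have hts2 : ∀ v, tsupport (fun x => fderiv ℝ (fun y => fderiv ℝ ψ y v) x v) ⊆ D := fun v =>
    (tsupport_fderiv_apply_subset ℝ v).trans (hts v)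
  have hint0 : ∀ v, Integrable fun x => u x * fderiv ℝ (fun y => fderiv ℝ ψ y v) x v := fun v =>
    integrable_mul_of_tsupport_subset hD hcont ((hψ.fderiv_apply v).fderiv_apply v).1.continuous
      ((hψ.fderiv_apply v).fderiv_apply v).2 (hts2 v)
  have hint1 : ∀ v, Integrable fun x => fderiv ℝ u x v * fderiv ℝ ψ x v := fun v =>
    integrable_mul_of_tsupport_subset hD (hcont1 v) (hψ.fderiv_apply v).1.continuous
      (hψ.fderiv_apply v).2 (hts v)
  have hint2 : ∀ v, Integrable fun x => fderiv ℝ (fun y => fderiv ℝ u y v) x v * ψ x := fun v =>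
    integrable_mul_of_tsupport_subset hD (hcont2 v) hψ.1.continuous hψ.2 hψD
  have hparts : ∀ v, ∫ x, u x * fderiv ℝ (fun y => fderiv ℝ ψ y v) x v
      = ∫ x, fderiv ℝ (fun y => fderiv ℝ u y v) x v * ψ x := by
    intro v
    rw [integral_mul_fderiv_eq_neg_fderiv_mul_of_integrable (hint1 v) (hint0 v)
      (integrable_mul_of_tsupport_subset hD hcont (hψ.fderiv_apply v).1.continuous
        (hψ.fderiv_apply v).2 (hts v)) (fun x hx => hdiff x (hts v hx))
      (fun x _ => ((hψ.fderiv_apply v).1.differentiable (by simp)) x),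
      integral_mul_fderiv_eq_neg_fderiv_mul_of_integrable (hint2 v) (hint1 v)
      (integrable_mul_of_tsupport_subset hD (hcont1 v) hψ.1.continuous hψ.2 hψD)
      (fun x hx => (hu1 v x (hψD hx)).differentiableAt (by norm_num))
      (fun x _ => (hψ.1.differentiable (by simp)) x), neg_neg]
  have e : ∀ x, u x * lap ψ x = ∑ i : Fin d, u x *
      fderiv ℝ (fun y => fderiv ℝ ψ y (EuclideanSpace.single i 1)) x (EuclideanSpace.single i 1) :=
    fun x => by rw [lap_eq_sum_fderiv hψ.contDiff_two.contDiffAt, Finset.mul_sum]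
  simp_rw [e]
  rw [integral_finsetSum _ fun i _ => hint0 _]
  simp_rw [hparts]
  rw [← integral_finsetSum _ fun i _ => hint2 _]
  refine integral_eq_zero_of_ae (Eventually.of_forall fun x => ?_)
  simp only [Pi.zero_apply]
  rw [← Finset.sum_mul]
  by_cases hx : x ∈ tsupport ψ
  · rw [← lap_eq_sum_fderiv (huat x (hψD hx)), hu.2 x (hψD hx), zero_mul]
  · rw [image_eq_zero_of_notMem_tsupport hx, mul_zero]

end Laplacian

section Shell

theorem lap_comp_norm_sq {d : ℕ} {G : ℝ → ℝ} (hG : ContDiff ℝ 2 G) (x : Euc d) :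
    lap (fun y : Euc d => G (‖y‖ ^ 2)) x
      = 4 * ‖x‖ ^ 2 * deriv (deriv G) (‖x‖ ^ 2) + 2 * d * deriv G (‖x‖ ^ 2) := by
  have hG1 : ContDiff ℝ 1 (deriv G) := by
    have : ContDiff ℝ (1 + 1) G := hG
    exact (contDiff_succ_iff_deriv.1 this).2.2
  have hN : ∀ y : Euc d, HasFDerivAt (fun y : Euc d => ‖y‖ ^ 2) (2 • innerSL ℝ y) y := fun y =>
    (hasStrictFDerivAt_norm_sq y).hasFDerivAt
  have h1 : ∀ y v : Euc d, fderiv ℝ (fun y : Euc d => G (‖y‖ ^ 2)) y v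
      = deriv G (‖y‖ ^ 2) * (2 * inner ℝ v y) := by
    intro y v
    have hd : HasDerivAt G (deriv G (‖y‖ ^ 2)) (‖y‖ ^ 2) :=
      (hG.differentiable (by norm_num) _).hasDerivAt
    have hc : HasFDerivAt (fun y : Euc d => G (‖y‖ ^ 2)) _ y := hd.comp_hasFDerivAt y (hN y)
    rw [hc.fderiv]
    simp [real_inner_comm]
  have h2 : ∀ v : Euc d, fderiv ℝ (fun y => fderiv ℝ (fun y : Euc d => G (‖y‖ ^ 2)) y v) x v
      = 4 * deriv (deriv G) (‖x‖ ^ 2) * (inner ℝ v x) ^ 2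
        + 2 * deriv G (‖x‖ ^ 2) * inner ℝ v v := by
    intro v
    have hfun : (fun y => fderiv ℝ (fun y : Euc d => G (‖y‖ ^ 2)) y v)
        = fun y => deriv G (‖y‖ ^ 2) * (2 * inner ℝ v y) := funext fun y => h1 y v
    have hd : HasDerivAt (deriv G) (deriv (deriv G) (‖x‖ ^ 2)) (‖x‖ ^ 2) :=
      (hG1.differentiable (by norm_num) _).hasDerivAt
    have ha : HasFDerivAt (fun y : Euc d => deriv G (‖y‖ ^ 2))
        (deriv (deriv G) (‖x‖ ^ 2) • 2 • innerSL ℝ x) x :=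
      HasDerivAt.comp_hasFDerivAt (h₂ := deriv G) x hd (hN x)
    have hb : HasFDerivAt (fun y : Euc d => 2 * inner ℝ v y) (2 • innerSL ℝ v) x := by
      refine (((innerSL ℝ v).hasFDerivAt (x := x)).const_mul 2).congr_fderiv ?_
      ext; simp
    rw [hfun]
    change fderiv ℝ ((fun y : Euc d => deriv G (‖y‖ ^ 2)) * fun y => 2 * inner ℝ v y) x v = _
    rw [(ha.mul hb).fderiv]
    simp [real_inner_comm]
    ring
  have hc : ContDiffAt ℝ 2 (fun y : Euc d => G (‖y‖ ^ 2)) x :=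
    (hG.comp (contDiff_norm_sq ℝ)).contDiffAt
  rw [lap_eq_sum_fderiv hc]
  simp_rw [h2]
  rw [Finset.sum_add_distrib, ← Finset.mul_sum, ← Finset.mul_sum]
  have e1 : ∑ i : Fin d, (inner ℝ (EuclideanSpace.single i (1 : ℝ)) x) ^ 2 = ‖x‖ ^ 2 := by
    rw [EuclideanSpace.norm_sq_eq]
    refine Finset.sum_congr rfl fun i _ => ?_
    rw [EuclideanSpace.inner_single_left]
    simp
  have e2 : ∑ i : Fin d, inner ℝ (EuclideanSpace.single i (1 : ℝ)) (EuclideanSpace.single i (1 : ℝ))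
      = (d : ℝ) := by simp
  rw [e1, e2]
  ring

/-- A smooth monotone function equal to `0` before `a` and to `1` after `b`. -/
def smoothStep (a b t : ℝ) : ℝ := Real.smoothTransition ((t - a) / (b - a))

/-- A smooth nonnegative radial function supported on `{x | a ≤ ‖x‖ ^ 2 ≤ b}`, with total mass
independent of `a` and `b`. -/
def shell (d : ℕ) (a b : ℝ) (x : Euc d) : ℝ :=
  4 * ((‖x‖ ^ 2) ^ (1 - (d : ℝ) / 2) * deriv (smoothStep a b) (‖x‖ ^ 2))

variable {a b a' b' : ℝ}

theorem contDiff_smoothStep : ContDiff ℝ (⊤ : ℕ∞) (smoothStep a b) :=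
  Real.smoothTransition.contDiff.comp (by fun_prop)

theorem contDiff_deriv_smoothStep : ContDiff ℝ (⊤ : ℕ∞) (deriv (smoothStep a b)) :=
  (contDiff_infty_iff_deriv.1 contDiff_smoothStep).2

theorem smoothStep_of_le (hab : a < b) {t : ℝ} (ht : t ≤ a) : smoothStep a b t = 0 :=
  Real.smoothTransition.zero_of_nonpos (div_nonpos_of_nonpos_of_nonneg (by linarith) (by linarith))

theorem smoothStep_of_ge (hab : a < b) {t : ℝ} (ht : b ≤ t) : smoothStep a b t = 1 :=
  Real.smoothTransition.one_of_one_le ((one_le_div (by linarith)).2 (by linarith))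

theorem deriv_smoothStep_nonneg (hab : a < b) (t : ℝ) : 0 ≤ deriv (smoothStep a b) t := by
  refine Monotone.deriv_nonneg fun s t hst => Real.smoothTransition.monotone ?_
  have : 0 < b - a := by linarith
  gcongr

theorem deriv_smoothStep_of_lt (hab : a < b) {t : ℝ} (ht : t < a) :
    deriv (smoothStep a b) t = 0 := by
  have : smoothStep a b =ᶠ[𝓝 t] fun _ => 0 := by
    filter_upwards [Iio_mem_nhds ht] with s hs using smoothStep_of_le hab (le_of_lt hs)
  rw [this.deriv_eq, deriv_const]

theorem deriv_smoothStep_of_gt (hab : a < b) {t : ℝ} (ht : b < t) :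
    deriv (smoothStep a b) t = 0 := by
  have : smoothStep a b =ᶠ[𝓝 t] fun _ => 1 := by
    filter_upwards [Ioi_mem_nhds ht] with s hs using smoothStep_of_ge hab (le_of_lt hs)
  rw [this.deriv_eq, deriv_const]

theorem contDiff_rpow_mul {w : ℝ → ℝ} (hw : ContDiff ℝ (⊤ : ℕ∞) w) (ha : 0 < a)
    (hwa : ∀ t < a, w t = 0) (p : ℝ) : ContDiff ℝ (⊤ : ℕ∞) fun t => t ^ p * w t := by
  rw [contDiff_iff_contDiffAt]
  intro t
  rcases lt_or_ge t a with h | h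
  · have : (fun t => t ^ p * w t) =ᶠ[𝓝 t] fun _ => 0 := by
      filter_upwards [Iio_mem_nhds h] with s hs
      rw [hwa s hs, mul_zero]
    exact contDiffAt_const.congr_of_eventuallyEq this
  · exact (Real.contDiffAt_rpow_const_of_ne (by linarith)).mul hw.contDiffAt

variable {d : ℕ}

theorem shell_nonneg (hab : a < b) (x : Euc d) : 0 ≤ shell d a b x := by
  have := deriv_smoothStep_nonneg hab (‖x‖ ^ 2)
  unfold shell
  positivity

theorem shell_congr_norm {x y : Euc d} (h : ‖x‖ = ‖y‖) : shell d a b x = shell d a b y := by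
  simp [shell, h]

theorem tsupport_shell_subset (hab : a < b) :
    tsupport (shell d a b) ⊆ {x | ‖x‖ ^ 2 ∈ Icc a b} := by
  refine closure_minimal (fun x hx => ?_) (isClosed_Icc.preimage (by fun_prop))
  by_contra h
  refine hx ?_
  have : deriv (smoothStep a b) (‖x‖ ^ 2) = 0 := by
    rcases lt_or_ge (‖x‖ ^ 2) a with h1 | h1
    · exact deriv_smoothStep_of_lt hab h1
    · exact deriv_smoothStep_of_gt hab (not_le.1 fun h2 => h ⟨h1, h2⟩)
  simp [shell, this]

theorem hasCompactSupport_of_tsupport_subset_norm_sq {f : Euc d → ℝ}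
    (h : tsupport f ⊆ {x | ‖x‖ ^ 2 ≤ b}) : HasCompactSupport f := by
  refine HasCompactSupport.of_support_subset_isCompact (isCompact_closedBall (0 : Euc d) (√b))
    fun x hx => ?_
  rw [mem_closedBall_zero_iff]
  exact Real.le_sqrt_of_sq_le (h (subset_tsupport _ hx))

theorem isTestFun_shell (ha : 0 < a) (hab : a < b) : IsTestFun (shell d a b) := by
  refine ⟨?_, hasCompactSupport_of_tsupport_subset_norm_sq
    ((tsupport_shell_subset hab).trans fun x hx => hx.2)⟩
  have h := contDiff_rpow_mul contDiff_deriv_smoothStep ha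
    (fun t ht => deriv_smoothStep_of_lt hab ht) (1 - (d : ℝ) / 2)
  exact contDiff_const.mul (h.comp (contDiff_norm_sq ℝ))

/-- The difference of two shells is the Laplacian of a test function. -/
theorem exists_lap_eq_shell_sub_shell (ha : 0 < a) (hab : a < b) (ha' : 0 < a') (hab' : a' < b') :
    ∃ ψ : Euc d → ℝ, IsTestFun ψ ∧ tsupport ψ ⊆ {x | ‖x‖ ^ 2 ≤ max b b'} ∧
      lap ψ = shell d a b - shell d a' b' := by
  set w : ℝ → ℝ := smoothStep a b - smoothStep a' b' with hw
  have hwc : ContDiff ℝ (⊤ : ℕ∞) w := contDiff_smoothStep.sub contDiff_smoothStep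
  have hw0 : ∀ t < min a a', w t = 0 := fun t ht => by
    simp [hw, smoothStep_of_le hab (ht.le.trans (min_le_left _ _)),
      smoothStep_of_le hab' (ht.le.trans (min_le_right _ _))]
  have hw1 : ∀ t, max b b' ≤ t → w t = 0 := fun t ht => by
    simp [hw, smoothStep_of_ge hab ((le_max_left _ _).trans ht),
      smoothStep_of_ge hab' ((le_max_right _ _).trans ht)]
  have hmin : 0 < min a a' := lt_min ha ha'
  set k : ℝ → ℝ := fun t => t ^ (-((d : ℝ) / 2)) * w t with hk
  have hkc : ContDiff ℝ (⊤ : ℕ∞) k := contDiff_rpow_mul hwc hmin hw0 _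
  set G : ℝ → ℝ := fun t => ∫ u in (max b b')..t, k u with hG
  have hGd : deriv G = k := funext fun t => hkc.continuous.deriv_integral k (max b b') t
  have hGc : ContDiff ℝ (⊤ : ℕ∞) G := by
    refine contDiff_infty_iff_deriv.2 ⟨fun t => ?_, hGd ▸ hkc⟩
    exact (hkc.continuous.integral_hasStrictDerivAt (max b b') t).hasDerivAt.differentiableAt
  have hG0 : ∀ t, max b b' ≤ t → G t = 0 := fun t ht => by
    refine intervalIntegral.integral_zero_ae (Eventually.of_forall fun u hu => ?_)
    rw [uIoc_of_le ht] at hu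
    simp [hk, hw1 u hu.1.le]
  have hsupp : tsupport (fun x : Euc d => G (‖x‖ ^ 2)) ⊆ {x | ‖x‖ ^ 2 ≤ max b b'} := by
    refine closure_minimal (fun x hx => ?_) (isClosed_le (by fun_prop) continuous_const)
    by_contra h
    exact hx (hG0 _ (not_le.1 h).le)
  refine ⟨fun x => G (‖x‖ ^ 2), ⟨hGc.comp (contDiff_norm_sq ℝ),
    hasCompactSupport_of_tsupport_subset_norm_sq hsupp⟩, hsupp, funext fun x => ?_⟩
  rw [lap_comp_norm_sq (hGc.of_le (WithTop.coe_le_coe.2 (le_top : (2 : ℕ∞) ≤ ⊤))), hGd]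
  have hwd : deriv w (‖x‖ ^ 2)
      = deriv (smoothStep a b) (‖x‖ ^ 2) - deriv (smoothStep a' b') (‖x‖ ^ 2) :=
    deriv_sub (contDiff_smoothStep.differentiable (by simp) _)
      (contDiff_smoothStep.differentiable (by simp) _)
  rcases lt_or_ge (‖x‖ ^ 2) (min a a') with h | h
  · have hkz : k =ᶠ[𝓝 (‖x‖ ^ 2)] fun _ => 0 := by
      filter_upwards [Iio_mem_nhds h] with s hs
      simp [hk, hw0 s hs]
    rw [hkz.deriv_eq, hkz.eq_of_nhds]
    simp [shell, deriv_smoothStep_of_lt hab (h.trans_le (min_le_left _ _)),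
      deriv_smoothStep_of_lt hab' (h.trans_le (min_le_right _ _))]
  · have hpos : 0 < ‖x‖ ^ 2 := hmin.trans_le h
    have hkd : HasDerivAt k _ (‖x‖ ^ 2) :=
      (Real.hasDerivAt_rpow_const (p := -((d : ℝ) / 2)) (Or.inl hpos.ne')).mul
        ((hwc.differentiable (by simp) _).hasDerivAt)
    rw [hkd.deriv, hwd]
    simp only [hk, shell, Pi.sub_apply]
    generalize ‖x‖ ^ 2 = s at hpos
    have e1 : s ^ (1 - (d : ℝ) / 2) = s * s ^ (-((d : ℝ) / 2)) := by
      rw [sub_eq_add_neg, Real.rpow_add hpos, Real.rpow_one]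
    have e2 : s * s ^ (-((d : ℝ) / 2) - 1) = s ^ (-((d : ℝ) / 2)) := by
      rw [Real.rpow_sub hpos, Real.rpow_one]
      field_simp
    rw [e1, ← e2]
    ring

theorem isHarmonicOn_const (c : ℝ) (s : Set (Euc d)) : IsHarmonicOn (fun _ => c) s := by
  refine ⟨contDiffOn_const, fun x _ => ?_⟩
  rw [lap_eq_sum_fderiv contDiffAt_const]
  simp

theorem integrable_shell (ha : 0 < a) (hab : a < b) : Integrable (shell d a b) :=
  (isTestFun_shell ha hab).1.continuous.integrable_of_hasCompactSupport (isTestFun_shell ha hab).2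

theorem integral_shell_eq (ha : 0 < a) (hab : a < b) (ha' : 0 < a') (hab' : a' < b') :
    ∫ x, shell d a b x = ∫ x, shell d a' b' x := by
  obtain ⟨ψ, hψ, -, hlap⟩ := exists_lap_eq_shell_sub_shell (d := d) ha hab ha' hab'
  have := integral_harmonic_mul_lap isOpen_univ (isHarmonicOn_const 1 univ) hψ (subset_univ _)
  simp only [hlap, Pi.sub_apply, one_mul] at this
  rw [integral_sub (integrable_shell ha hab) (integrable_shell ha' hab')] at this
  linarith

theorem exists_shell_pos (hd : 0 < d) (ha : 0 < a) (hab : a < b) :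
    ∃ x, 0 < shell d a b x := by
  obtain ⟨t, ht, hder⟩ := exists_deriv_eq_slope (smoothStep a b) hab
    contDiff_smoothStep.continuous.continuousOn
    (contDiff_smoothStep.differentiable (by simp)).differentiableOn
  rw [smoothStep_of_ge hab le_rfl, smoothStep_of_le hab le_rfl, sub_zero] at hder
  have ht0 : 0 < t := ha.trans ht.1
  refine ⟨EuclideanSpace.single ⟨0, hd⟩ (√t), ?_⟩
  have hn : ‖(EuclideanSpace.single (⟨0, hd⟩ : Fin d) (√t) : Euc d)‖ ^ 2 = t := by
    rw [PiLp.norm_single, Real.norm_eq_abs, sq_abs, Real.sq_sqrt ht0.le]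
  have : 0 < b - a := by linarith
  rw [shell, hn, hder]
  positivity

theorem integral_shell_pos (hd : 0 < d) (ha : 0 < a) (hab : a < b) :
    0 < ∫ x, shell d a b x := by
  obtain ⟨x, hx⟩ := exists_shell_pos hd ha hab
  exact (isTestFun_shell ha hab).1.continuous.integral_pos_of_hasCompactSupport_nonneg_nonzero
    (isTestFun_shell ha hab).2 (fun x => shell_nonneg hab x) hx.ne'

theorem shell_scaling {r : ℝ} (hr : 0 < r) (hab : a < b) (x : Euc d) :
    shell d (a * r ^ 2) (b * r ^ 2) x = (r ^ d)⁻¹ * shell d a b (r⁻¹ • x) := by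
  have hfun : smoothStep (a * r ^ 2) (b * r ^ 2) = fun t => smoothStep a b ((r ^ 2)⁻¹ * t) := by
    ext t
    have : b - a ≠ 0 := by linarith
    unfold smoothStep
    congr 1
    rw [← sub_mul]
    field_simp
  have hn : ‖r⁻¹ • x‖ ^ 2 = (r ^ 2)⁻¹ * ‖x‖ ^ 2 := by
    rw [norm_smul, mul_pow, norm_inv, Real.norm_eq_abs, abs_of_pos hr, inv_pow]
  rw [shell, shell, hfun, hn, deriv_comp_mul_left (f := smoothStep a b),
    Real.mul_rpow (by positivity) (by positivity), Real.inv_rpow (by positivity)]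
  have e : (r ^ 2) ^ (1 - (d : ℝ) / 2) = r ^ 2 * (r ^ d)⁻¹ := by
    rw [← Real.rpow_natCast r 2, ← Real.rpow_mul hr.le, ← Real.rpow_natCast r d,
      ← Real.rpow_neg hr.le, ← Real.rpow_add hr]
    congr 1
    push_cast
    ring
  rw [e, smul_eq_mul]
  have : (r ^ d) ≠ 0 := by positivity
  field_simp

end Shell

section Field

variable {d : ℕ}

theorem IsTestFun.comp_affine {f : Euc d → ℝ} (hf : IsTestFun f) (a : Euc d) {r : ℝ} (hr : r ≠ 0) :
    IsTestFun fun y => f (a + r • y) :=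
  ⟨hf.1.comp (by fun_prop),
    hf.2.comp_homeomorph ((Homeomorph.smulOfNeZero r hr).trans (Homeomorph.addLeft a))⟩

theorem IsTestFun.add {f g : Euc d → ℝ} (hf : IsTestFun f) (hg : IsTestFun g) : IsTestFun (f + g) :=
  ⟨hf.1.add hg.1, hf.2.add hg.2⟩

theorem IsTestFun.smul {f : Euc d → ℝ} (hf : IsTestFun f) (c : ℝ) : IsTestFun (c • f) :=
  ⟨contDiff_const.smul hf.1, hf.2.smul_left⟩

theorem IsTestFun.zero : IsTestFun (0 : Euc d → ℝ) := ⟨contDiff_const, HasCompactSupport.zero⟩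

theorem IsTestFun.sum {ι : Type*} (s : Finset ι) {f : ι → Euc d → ℝ}
    (hf : ∀ i ∈ s, IsTestFun (f i)) : IsTestFun (∑ i ∈ s, f i) :=
  Finset.sum_induction f IsTestFun (fun _ _ => IsTestFun.add) IsTestFun.zero hf

theorem tsupport_comp_affine_subset (f : Euc d → ℝ) (a : Euc d) (r : ℝ) :
    tsupport (fun y => f (a + r • y)) ⊆ (fun y => a + r • y) ⁻¹' tsupport f :=
  tsupport_comp_subset_preimage f (by fun_prop)

theorem measurable_iSup_comap {Ω ι : Type*} {F : ι → Ω → ℝ} (i : ι) :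
    Measurable[⨆ i, MeasurableSpace.comap (F i) inferInstance] (F i) :=
  measurable_iff_comap_le.2 (le_iSup (fun i => MeasurableSpace.comap (F i) inferInstance) i)

theorem IsTestFun.exists_sum_eq {ψ : Euc d → ℝ} (hψ : IsTestFun ψ)
    {U : Euc d → Set (Euc d)} (hU : ∀ x ∈ tsupport ψ, U x ∈ 𝓝 x) (hUo : ∀ x, IsOpen (U x)) :
    ∃ (t : Finset (Euc d)) (φ : t → Euc d → ℝ), (∀ x : t, (x : Euc d) ∈ tsupport ψ) ∧
      (∀ x, IsTestFun (φ x)) ∧ (∀ x, tsupport (φ x) ⊆ U x) ∧ ∑ x, φ x = ψ := by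
  obtain ⟨t, ht, hcov⟩ := hψ.2.isCompact.elim_nhds_subcover U hU
  obtain ⟨p, hp⟩ := SmoothPartitionOfUnity.exists_isSubordinate (modelWithCornersSelf ℝ (Euc d))
    (isClosed_tsupport ψ) (fun x : t => U x) (fun x => hUo x) (by simpa [iUnion_subtype] using hcov)
  refine ⟨t, fun x => p x * ψ, fun x => ht x x.2, fun x => ⟨?_, hψ.2.mul_left⟩, fun x =>
    (tsupport_mul_subset_left).trans (hp x), funext fun y => ?_⟩
  · exact (p x).contMDiff.contDiff.mul hψ.1
  · rw [Finset.sum_apply]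
    simp only [Pi.mul_apply]
    rw [← Finset.sum_mul]
    by_cases hy : y ∈ tsupport ψ
    · rw [← finsum_eq_sum_of_fintype, p.sum_eq_one hy, one_mul]
    · rw [image_eq_zero_of_notMem_tsupport hy, mul_zero]

theorem charDefect_sum {Ω ι : Type*} [MeasurableSpace Ω] {P : Measure Ω} (s : Finset ι)
    {F : ι → Ω → ℝ} {G₁ G₂ : Ω → ℝ} (hF : ∀ i ∈ s, Integrable (F i) P) (h₁ : AEMeasurable G₁ P)
    (h₂ : AEMeasurable G₂ P) :
    charDefect P (∑ i ∈ s, F i) G₁ G₂ = ∑ i ∈ s, charDefect P (F i) G₁ G₂ := by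
  classical
  induction s using Finset.induction_on with
  | empty => simpa using charDefect_smul (P := P) (F := 0) (G₁ := G₁) (G₂ := G₂) 0
  | insert i s hi ih =>
    have hs := fun j hj => hF j (Finset.mem_insert_of_mem hj)
    rw [Finset.sum_insert hi, Finset.sum_insert hi,
      charDefect_add (hF i (Finset.mem_insert_self _ _)) (integrable_finsetSum' _ hs) h₁ h₂, ih hs]

theorem tendsto_eLpNorm_two_of_integral_sq {Ω ι : Type*} [MeasurableSpace Ω] {P : Measure Ω}
    {l : Filter ι} {F : ι → Ω → ℝ} (hF : ∀ n, MemLp (F n) 2 P)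
    (h : Tendsto (fun n => ∫ ω, F n ω ^ 2 ∂P) l (𝓝 0)) :
    Tendsto (fun n => eLpNorm (F n) 2 P) l (𝓝 0) := by
  have h1 : ∀ n, eLpNorm (F n) 2 P = ENNReal.ofReal (√(∫ ω, F n ω ^ 2 ∂P)) := fun n => by
    rw [(hF n).eLpNorm_eq_integral_rpow_norm (by norm_num) (by norm_num), Real.sqrt_eq_rpow]
    simp
  simp only [h1]
  have := (ENNReal.continuous_ofReal.comp Real.continuous_sqrt).tendsto 0
  simp only [Function.comp_apply, Real.sqrt_zero, ENNReal.ofReal_zero] at this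
  exact this.comp h

/-- An increasing sequence in `(0, 1)` with limit `1`. -/
def radius (n : ℕ) : ℝ := 1 - 1 / (n + 2)

theorem radius_pos (n : ℕ) : 0 < radius n := by
  have : (1 : ℝ) / (n + 2) < 1 := by
    rw [div_lt_one (by positivity)]
    linarith [n.cast_nonneg (α := ℝ)]
  unfold radius
  linarith

theorem radius_lt_one (n : ℕ) : radius n < 1 := by
  have : (0 : ℝ) < 1 / (n + 2) := by positivity
  unfold radius
  linarith

theorem strictMono_radius : StrictMono radius := fun m n hmn => by
  have : (m : ℝ) < n := by exact_mod_cast hmn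
  unfold radius
  gcongr

theorem tendsto_radius : Tendsto radius atTop (𝓝 1) := by
  have : Tendsto (fun n : ℕ => (1 : ℝ) / ((n : ℝ) + 2)) atTop (𝓝 0) := by
    simpa [one_div, Function.comp_def] using tendsto_inv_atTop_zero.comp
      (tendsto_atTop_add_const_right atTop (2 : ℝ) tendsto_natCast_atTop_atTop)
  have h := this.const_sub 1
  rwa [sub_zero] at h

theorem tendsto_two_mul_atTop : Tendsto (fun n : ℕ => 2 * n) atTop atTop :=
  tendsto_atTop_mono (fun n => by simp only [id]; omega) tendsto_id

namespace GFF

variable {Ω : Type} [MeasurableSpace Ω] (X : GFF d Ω)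

theorem memLp_h {f : Euc d → ℝ} (hf : IsTestFun f) : MemLp (X.h 0 1 f) 2 X.P := by
  have hm := (X.meas_h 0 1 f)
  refine (memLp_two_iff_integrable_sq hm.aestronglyMeasurable).2
    (((integrable_const (1 : ℝ)).add (X.mom4 f hf)).mono' (by fun_prop)
      (Eventually.of_forall fun ω => ?_))
  rw [Real.norm_eq_abs, abs_of_nonneg (sq_nonneg _)]
  simp only [Pi.add_apply]
  nlinarith [sq_nonneg (X.h 0 1 f ω ^ 2 - 1)]

theorem h_smul {f : Euc d → ℝ} (hf : IsTestFun f) (c : ℝ) :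
    X.h 0 1 (c • f) =ᵐ[X.P] c • X.h 0 1 f := X.lin_smul c f hf

theorem h_add {f g : Euc d → ℝ} (hf : IsTestFun f) (hg : IsTestFun g) :
    X.h 0 1 (f + g) =ᵐ[X.P] X.h 0 1 f + X.h 0 1 g := X.lin_add f g hf hg

theorem h_zero : X.h 0 1 0 =ᵐ[X.P] 0 := by
  simpa using X.h_smul IsTestFun.zero 0

theorem h_sum {ι : Type*} (s : Finset ι) {f : ι → Euc d → ℝ} (hf : ∀ i ∈ s, IsTestFun (f i)) :
    X.h 0 1 (∑ i ∈ s, f i) =ᵐ[X.P] ∑ i ∈ s, X.h 0 1 (f i) := by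
  classical
  induction s using Finset.induction_on with
  | empty => simpa using X.h_zero
  | insert i s hi ih =>
    rw [Finset.sum_insert hi, Finset.sum_insert hi]
    have hs := fun j hj => hf j (Finset.mem_insert_of_mem hj)
    exact (X.h_add (hf i (Finset.mem_insert_self _ _)) (IsTestFun.sum s hs)).trans
      (EventuallyEq.rfl.add (ih hs))

variable {a : Euc d} {r : ℝ} {f : Euc d → ℝ}

theorem identDistrib_H (hr : 0 < r) (hsub : ball a r ⊆ ball 0 1) (hf : IsTestFun f) :
    IdentDistrib (X.H a r f)
      (fun ω => r ^ (1 + (d : ℝ) / 2) * X.h 0 1 (fun y => f (a + r • y)) ω) X.P X.P := by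
  refine ⟨(X.meas_H _ _ _).aemeasurable, ((X.meas_h _ _ _).const_mul _).aemeasurable, ?_⟩
  have h1 := X.dmp_law a r hr hsub 1 (fun _ => f) fun _ => hf
  have h2 := X.scaling a r hr 1 (fun _ y => f (a + r • y)) fun _ => hf.comp_affine a hr.ne'
  simp only [smul_inv_smul₀ hr.ne', add_sub_cancel] at h2
  have h3 := congrArg (Measure.map fun v : Fin 1 → ℝ => v 0) (h1.trans h2)
  rwa [Measure.map_map (by fun_prop) (measurable_pi_lambda _ fun _ => X.meas_H _ _ _),
    Measure.map_map (by fun_prop)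
      (measurable_pi_lambda _ fun _ => (X.meas_h _ _ _).const_mul _)] at h3

theorem memLp_H (hr : 0 < r) (hsub : ball a r ⊆ ball 0 1) (hf : IsTestFun f) :
    MemLp (X.H a r f) 2 X.P :=
  (X.identDistrib_H hr hsub hf).symm.memLp_snd
    ((X.memLp_h (hf.comp_affine a hr.ne')).const_mul _)

theorem integral_H (hr : 0 < r) (hsub : ball a r ⊆ ball 0 1) (hf : IsTestFun f) :
    ∫ ω, X.H a r f ω ∂X.P = 0 := by
  rw [(X.identDistrib_H hr hsub hf).integral_eq, integral_const_mul,
    X.centered 0 1 _ (hf.comp_affine a hr.ne'), mul_zero]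

theorem integral_H_sq (hr : 0 < r) (hsub : ball a r ⊆ ball 0 1) (hf : IsTestFun f) :
    ∫ ω, X.H a r f ω ^ 2 ∂X.P
      = (r ^ (1 + (d : ℝ) / 2)) ^ 2 * ∫ ω, X.h 0 1 (fun y => f (a + r • y)) ω ^ 2 ∂X.P := by
  have := ((X.identDistrib_H hr hsub hf).comp (measurable_id.pow_const 2)).integral_eq
  simp only [Function.comp_def, id] at this
  rw [this, ← integral_const_mul]
  simp only [mul_pow]

theorem H_eq_zero (hr : 0 < r) (hsub : ball a r ⊆ ball 0 1) (hf : IsTestFun f)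
    (hfs : Disjoint (tsupport f) (ball a r)) : X.H a r f =ᵐ[X.P] 0 := by
  have h0 := X.zero_outside _ (hf.comp_affine a hr.ne') fun y hy hy1 => by
    refine disjoint_left.1 hfs (tsupport_comp_affine_subset f a r hy) ?_
    rw [mem_ball_zero_iff] at hy1
    rw [mem_ball, dist_eq_norm, add_sub_cancel_left, norm_smul, Real.norm_eq_abs, abs_of_pos hr]
    nlinarith
  refine (X.identDistrib_H hr hsub hf).symm.ae_snd (p := fun t => t = 0)
    (measurableSet_singleton 0) ?_
  filter_upwards [h0] with ω hω
  rw [hω, mul_zero]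

theorem Φ_eq_integral (hr : 0 < r) (hsub : ball a r ⊆ ball 0 1) :
    ∀ᵐ ω ∂X.P, IsHarmonicOn (X.φharm a r ω) (ball a r) ∧
      ∀ f : Euc d → ℝ, IsTestFun f → tsupport f ⊆ ball a r →
        X.Φ a r f ω = ∫ x, X.φharm a r ω x * f x := by
  filter_upwards [X.dmp_harm a r hr hsub] with ω hω
  refine ⟨hω.1, fun f hf hfs => ?_⟩
  rw [hω.2 f hf hfs]
  refine setIntegral_eq_integral_of_forall_compl_eq_zero fun x hx => ?_
  rw [image_eq_zero_of_notMem_tsupport fun h => hx (hfs h), mul_zero]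

theorem h_lap_eq_H {ψ : Euc d → ℝ} (hr : 0 < r) (hsub : ball a r ⊆ ball 0 1) (hψ : IsTestFun ψ)
    (hψs : tsupport ψ ⊆ ball a r) : X.h 0 1 (lap ψ) =ᵐ[X.P] X.H a r (lap ψ) := by
  filter_upwards [X.dmp_decomp a r hr hsub _ hψ.lap, X.Φ_eq_integral hr hsub] with ω h1 h2
  rw [h1, h2.2 _ hψ.lap ((tsupport_lap_subset ψ).trans hψs),
    integral_harmonic_mul_lap isOpen_ball h2.1 hψ hψs, add_zero]

theorem charDefect_lap_of_ball {ψ g₁ g₂ : Euc d → ℝ} (hr : 0 < r) (hsub : ball a r ⊆ ball 0 1)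
    (hψ : IsTestFun ψ) (hψs : tsupport ψ ⊆ ball a r) (hg₁ : IsTestFun g₁) (hg₂ : IsTestFun g₂)
    (hg₂s : Disjoint (tsupport g₂) (ball a r)) :
    charDefect X.P (X.h 0 1 (lap ψ)) (X.h 0 1 g₁) (X.h 0 1 g₂) = 0 := by
  have h1 : X.h 0 1 g₁ =ᵐ[X.P] X.H a r g₁ + X.Φ a r g₁ := X.dmp_decomp a r hr hsub g₁ hg₁
  have h2 : X.h 0 1 g₂ =ᵐ[X.P] X.Φ a r g₂ := by
    filter_upwards [X.dmp_decomp a r hr hsub g₂ hg₂, X.H_eq_zero hr hsub hg₂ hg₂s] with ω h h'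
    rw [h, h', Pi.zero_apply, zero_add]
  rw [charDefect_congr (X.h_lap_eq_H hr hsub hψ hψs) h1 h2]
  have mH : ∀ f, IsTestFun f → Measurable[⨆ f : {f : Euc d → ℝ // IsTestFun f},
      MeasurableSpace.comap (X.H a r f.1) inferInstance] (X.H a r f) := fun f hf =>
    measurable_iSup_comap (F := fun f : {f : Euc d → ℝ // IsTestFun f} => X.H a r f.1) ⟨f, hf⟩
  have mΦ : ∀ f, IsTestFun f → Measurable[(⨆ f : {f : Euc d → ℝ // IsTestFun f},
      MeasurableSpace.comap (X.Φ a r f.1) inferInstance) ⊔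
        ⨆ z : Euc d, MeasurableSpace.comap (fun ω => X.φharm a r ω z) inferInstance]
      (X.Φ a r f) := fun f hf =>
    (measurable_iSup_comap (F := fun f : {f : Euc d → ℝ // IsTestFun f} => X.Φ a r f.1)
      ⟨f, hf⟩).mono le_sup_left le_rfl
  have hind := X.dmp_indep a r hr hsub
  refine charDefect_eq_zero_of_indep ?_ ?_ hind (mH _ hψ.lap) (mH _ hg₁) (mΦ _ hg₁) (mΦ _ hg₂)
    (X.integral_H hr hsub hψ.lap)
  · exact iSup_le fun f => (X.meas_H a r f.1).comap_le
  · exact sup_le (iSup_le fun f => (X.meas_Φ a r f.1).comap_le)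
      (iSup_le fun z => (X.meas_φharm a r z).comap_le)

theorem charDefect_lap {ψ g₁ g₂ : Euc d → ℝ} (hψ : IsTestFun ψ) (hψs : tsupport ψ ⊆ ball 0 1)
    (hg₁ : IsTestFun g₁) (hg₂ : IsTestFun g₂) (hdisj : Disjoint (tsupport g₁) (tsupport g₂)) :
    charDefect X.P (X.h 0 1 (lap ψ)) (X.h 0 1 g₁) (X.h 0 1 g₂) = 0 := by
  have hex : ∀ x : Euc d, ∃ ρ : ℝ, x ∈ tsupport ψ → 0 < ρ ∧ ball x ρ ⊆ ball 0 1 ∧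
      (Disjoint (tsupport g₁) (ball x ρ) ∨ Disjoint (tsupport g₂) (ball x ρ)) := by
    intro x
    by_cases hx : x ∈ tsupport ψ
    swap
    · exact ⟨0, fun h => absurd h hx⟩
    have key : ∀ g : Euc d → ℝ, x ∉ tsupport g → ∃ ρ : ℝ, 0 < ρ ∧ ball x ρ ⊆ ball 0 1 ∧
        Disjoint (tsupport g) (ball x ρ) := fun g hg => by
      obtain ⟨ρ, hρ, hb⟩ := Metric.mem_nhds_iff.1 (inter_mem (isOpen_ball.mem_nhds (hψs hx))
        ((isClosed_tsupport g).isOpen_compl.mem_nhds hg))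
      exact ⟨ρ, hρ, fun y hy => (hb hy).1,
        disjoint_left.2 fun y hy hy' => (hb hy').2 hy⟩
    by_cases h : x ∈ tsupport g₁
    · obtain ⟨ρ, h0, h1, h2⟩ := key g₂ (disjoint_left.1 hdisj h)
      exact ⟨ρ, fun _ => ⟨h0, h1, Or.inr h2⟩⟩
    · obtain ⟨ρ, h0, h1, h2⟩ := key g₁ h
      exact ⟨ρ, fun _ => ⟨h0, h1, Or.inl h2⟩⟩
  choose ρ hρ using hex
  obtain ⟨t, φ, ht, hφ, hφU, rfl⟩ := hψ.exists_sum_eq (U := fun x => ball x (ρ x))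
    (fun x hx => ball_mem_nhds x (hρ x hx).1) fun _ => isOpen_ball
  have hsum : X.h 0 1 (lap (∑ x, φ x)) =ᵐ[X.P] ∑ x, X.h 0 1 (lap (φ x)) := by
    rw [lap_sum _ fun x _ => hφ x]
    exact X.h_sum _ fun x _ => (hφ x).lap
  rw [charDefect_congr hsum .rfl .rfl, charDefect_sum _
    (fun x _ => X.integrable_h 0 1 _ (hφ x).lap) (X.meas_h _ _ _).aemeasurable
    (X.meas_h _ _ _).aemeasurable]
  refine Finset.sum_eq_zero fun x _ => ?_
  obtain ⟨h0, h1, h2 | h2⟩ := hρ x (ht x)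
  · rw [charDefect_comm]
    exact X.charDefect_lap_of_ball h0 h1 (hφ x) (hφU x) hg₂ hg₁ h2
  · exact X.charDefect_lap_of_ball h0 h1 (hφ x) (hφU x) hg₁ hg₂ h2

theorem tendsto_integral_h_shell_sq (hd : 0 < d) {a b : ℕ → ℝ} (ha : ∀ n, 0 < a n)
    (hab : ∀ n, a n < b n) (hb : ∀ n, b n < 1) (hat : Tendsto a atTop (𝓝 1)) :
    Tendsto (fun n => ∫ ω, X.h 0 1 (shell d (a n) (b n)) ω ^ 2 ∂X.P) atTop (𝓝 0) := by
  refine X.zero_bdry _ (fun n => isTestFun_shell (ha n) (hab n)) (fun n => shell_nonneg (hab n))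
    ⟨∫ x, shell d (a 0) (b 0) x, fun n =>
      (integral_shell_eq (ha n) (hab n) (ha 0) (hab 0)).le⟩ ?_
    ⟨1, fun n x y hxy _ => by rw [one_mul, shell_congr_norm hxy]⟩
  have hne : ∀ n, (tsupport (shell d (a n) (b n))).Nonempty := fun n => by
    obtain ⟨x, hx⟩ := exists_shell_pos hd (ha n) (hab n)
    exact ⟨x, subset_tsupport _ hx.ne'⟩
  have hsq : Tendsto (fun n => √(a n)) atTop (𝓝 1) := by
    simpa [Function.comp_def] using (Real.continuous_sqrt.tendsto 1).comp hat
  refine tendsto_of_tendsto_of_tendsto_of_le_of_le hsq tendsto_const_nhds (fun n => ?_) fun n => ?_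
  · refine (le_infDist (hne n)).2 fun y hy => ?_
    rw [dist_zero_left]
    exact Real.sqrt_le_iff.2 ⟨norm_nonneg _, (tsupport_shell_subset (hab n) hy).1⟩
  · obtain ⟨y, hy⟩ := hne n
    refine (infDist_le_dist_of_mem hy).trans ?_
    rw [dist_zero_left]
    have := (tsupport_shell_subset (hab n) hy).2
    nlinarith [hb n, norm_nonneg y]

theorem charDefect_shell (hd : 0 < d) {a b : ℝ} (ha : 0 < a) (hab : a < b) (hb : b < 1)
    {g₁ g₂ : Euc d → ℝ} (hg₁ : IsTestFun g₁) (hg₂ : IsTestFun g₂)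
    (hdisj : Disjoint (tsupport g₁) (tsupport g₂)) :
    charDefect X.P (X.h 0 1 (shell d a b)) (X.h 0 1 g₁) (X.h 0 1 g₂) = 0 := by
  set S : ℕ → Euc d → ℝ := fun n => shell d (radius n) (radius (n + 1)) with hS
  have hlt : ∀ n, radius n < radius (n + 1) := fun n => strictMono_radius n.lt_succ_self
  have hStest : ∀ n, IsTestFun (S n) := fun n => isTestFun_shell (radius_pos n) (hlt n)
  have heq : ∀ n, charDefect X.P (X.h 0 1 (S n)) (X.h 0 1 g₁) (X.h 0 1 g₂)
      = charDefect X.P (X.h 0 1 (shell d a b)) (X.h 0 1 g₁) (X.h 0 1 g₂) := fun n => by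
    obtain ⟨ψ, hψ, hψs, hlap⟩ :=
      exists_lap_eq_shell_sub_shell (d := d) ha hab (radius_pos n) (hlt n)
    have h1 : X.h 0 1 (shell d a b) =ᵐ[X.P] X.h 0 1 (lap ψ) + X.h 0 1 (S n) := by
      have := X.h_add hψ.lap (hStest n)
      rwa [hlap, sub_add_cancel, ← hlap] at this
    rw [charDefect_congr h1 .rfl .rfl, charDefect_add (X.integrable_h 0 1 _ hψ.lap)
      (X.integrable_h 0 1 _ (hStest n)) (X.meas_h _ _ _).aemeasurable
      (X.meas_h _ _ _).aemeasurable, X.charDefect_lap hψ (fun x hx => ?_) hg₁ hg₂ hdisj, zero_add]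
    have h2 : ‖x‖ ^ 2 ≤ max b (radius (n + 1)) := hψs hx
    have h3 := h2.trans_lt (max_lt hb (radius_lt_one _))
    rw [mem_ball_zero_iff]
    nlinarith [norm_nonneg x]
  have hlim := tendsto_eLpNorm_two_of_integral_sq (fun n => X.memLp_h (hStest n))
    (X.tendsto_integral_h_shell_sq hd radius_pos hlt (fun n => radius_lt_one _) tendsto_radius)
  have ht := tendsto_charDefect (P := X.P) (l := atTop) (Fn := fun n => X.h 0 1 (S n)) (F := 0)
    (Gn₁ := fun _ => X.h 0 1 g₁) (G₁ := X.h 0 1 g₁) (Gn₂ := fun _ => X.h 0 1 g₂)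
    (G₂ := X.h 0 1 g₂) (fun n => X.memLp_h (hStest n)) MemLp.zero
    (fun _ => X.memLp_h hg₁) (X.memLp_h hg₁) (fun _ => X.memLp_h hg₂) (X.memLp_h hg₂)
    (by simpa using hlim) (by simp) (by simp)
  simp only [heq] at ht
  rw [tendsto_nhds_unique tendsto_const_nhds ht]
  simpa using charDefect_smul (P := X.P) (F := 0) (G₁ := X.h 0 1 g₁) (G₂ := X.h 0 1 g₂) 0

end GFF

end Field

section MeanValue

variable {d : ℕ} {a b r : ℝ} {u : Euc d → ℝ}

theorem tsupport_shell_subset_ball (hr : 0 < r) (hab : a < b) (hb : b < r ^ 2) :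
    tsupport (shell d a b) ⊆ ball 0 r := fun x hx => by
  have h : ‖x‖ ^ 2 ≤ b := (tsupport_shell_subset hab hx).2
  exact mem_ball_zero_iff.2 (lt_of_pow_lt_pow_left₀ 2 hr.le (h.trans_lt hb))

theorem integrable_harmonic_mul_shell (hr : 0 < r) (hu : IsHarmonicOn u (ball 0 r)) (ha : 0 < a)
    (hab : a < b) (hb : b < r ^ 2) : Integrable fun x => u x * shell d a b x :=
  integrable_mul_of_tsupport_subset isOpen_ball hu.1.continuousOn
    (isTestFun_shell ha hab).1.continuous (isTestFun_shell ha hab).2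
    (tsupport_shell_subset_ball hr hab hb)

/-- The mean value property of harmonic functions, for averages over shells. -/
theorem integral_harmonic_mul_shell (hr : 0 < r) (hu : IsHarmonicOn u (ball 0 r)) (ha : 0 < a)
    (hab : a < b) (hb : b < r ^ 2) :
    ∫ x, u x * shell d a b x = u 0 * ∫ x, shell d a b x := by
  set c := ∫ x, shell d a b x with hc
  have hc0 : 0 ≤ c := integral_nonneg fun x => shell_nonneg hab x
  rw [← sub_eq_zero, ← abs_nonpos_iff]
  refine le_of_forall_pos_le_add fun ε hε => ?_
  have hcont : ContinuousAt u 0 := hu.1.continuousOn.continuousAt (ball_mem_nhds 0 hr)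
  obtain ⟨ρ, hρ, hρu⟩ := Metric.continuousAt_iff.1 hcont (ε / (c + 1)) (by positivity)
  set t := min ρ r with ht
  have ht0 : 0 < t := lt_min hρ hr
  have ha' : 0 < t ^ 2 / 4 := by positivity
  have hab' : t ^ 2 / 4 < t ^ 2 / 2 := by linarith
  have hbt : t ^ 2 / 2 < t ^ 2 := by linarith
  have hbr : t ^ 2 / 2 < r ^ 2 :=
    hbt.trans_le (pow_le_pow_left₀ ht0.le (min_le_right _ _) 2)
  obtain ⟨ψ, hψ, hψs, hlap⟩ := exists_lap_eq_shell_sub_shell (d := d) ha hab ha' hab'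
  have h0 := integral_harmonic_mul_lap isOpen_ball hu hψ fun x hx => by
    have h : ‖x‖ ^ 2 ≤ _ := hψs hx
    exact mem_ball_zero_iff.2 (lt_of_pow_lt_pow_left₀ 2 hr.le (h.trans_lt (max_lt hb hbr)))
  simp only [hlap, Pi.sub_apply, mul_sub] at h0
  rw [integral_sub (integrable_harmonic_mul_shell hr hu ha hab hb)
    (integrable_harmonic_mul_shell hr hu ha' hab' hbr)] at h0
  have h2 : ∫ x, u x * shell d a b x = ∫ x, u x * shell d (t ^ 2 / 4) (t ^ 2 / 2) x :=
    sub_eq_zero.1 h0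
  have hc' : c = ∫ x, shell d (t ^ 2 / 4) (t ^ 2 / 2) x := integral_shell_eq ha hab ha' hab'
  have hI := integrable_shell (d := d) ha' hab'
  have h1 : (∫ x, u x * shell d a b x) - u 0 * c
      = ∫ x, (u x - u 0) * shell d (t ^ 2 / 4) (t ^ 2 / 2) x := by
    simp only [sub_mul]
    rw [integral_sub (integrable_harmonic_mul_shell hr hu ha' hab' hbr) (hI.const_mul _),
      integral_const_mul, h2, hc']
  rw [h1, zero_add]
  calc |∫ x, (u x - u 0) * shell d (t ^ 2 / 4) (t ^ 2 / 2) x|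
      ≤ ∫ x, ε / (c + 1) * shell d (t ^ 2 / 4) (t ^ 2 / 2) x := by
        rw [← Real.norm_eq_abs]
        refine norm_integral_le_of_norm_le (hI.const_mul _) (Eventually.of_forall fun x => ?_)
        rw [norm_mul, Real.norm_of_nonneg (shell_nonneg hab' x)]
        by_cases hx : x ∈ tsupport (shell d (t ^ 2 / 4) (t ^ 2 / 2))
        · refine mul_le_mul_of_nonneg_right ?_ (shell_nonneg hab' x)
          have hxt := tsupport_shell_subset_ball ht0 hab' hbt hx
          exact (hρu (lt_of_lt_of_le hxt (min_le_left _ _))).le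
        · rw [image_eq_zero_of_notMem_tsupport hx, mul_zero, mul_zero]
    _ = ε / (c + 1) * c := by rw [integral_const_mul, hc']
    _ ≤ ε := by
        rw [div_mul_eq_mul_div, div_le_iff₀ (by positivity)]
        nlinarith

/-- Shells of total mass independent of `n` and `r`, concentrating at the sphere of radius `r`. -/
def shellSeq (d : ℕ) (r : ℝ) (n : ℕ) : Euc d → ℝ :=
  shell d (radius (2 * n) * r ^ 2) (radius (2 * n + 1) * r ^ 2)

theorem shellSeq_lt (hr : 0 < r) (n : ℕ) :
    radius (2 * n) * r ^ 2 < radius (2 * n + 1) * r ^ 2 := by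
  have := strictMono_radius (2 * n).lt_succ_self
  gcongr

theorem shellSeq_left_pos (hr : 0 < r) (n : ℕ) : 0 < radius (2 * n) * r ^ 2 := by
  have := radius_pos (2 * n)
  positivity

theorem shellSeq_right_lt (hr : 0 < r) (n : ℕ) : radius (2 * n + 1) * r ^ 2 < r ^ 2 :=
  mul_lt_of_lt_one_left (by positivity) (radius_lt_one _)

theorem isTestFun_shellSeq (hr : 0 < r) (n : ℕ) : IsTestFun (shellSeq d r n) :=
  isTestFun_shell (shellSeq_left_pos hr n) (shellSeq_lt hr n)

/-- The total mass of the shells. -/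
def shellMass (d : ℕ) : ℝ := ∫ x, shell d 1 2 x

theorem shellMass_pos (hd : 0 < d) : 0 < shellMass d :=
  integral_shell_pos hd one_pos one_lt_two

theorem integral_shellSeq (hr : 0 < r) (n : ℕ) : ∫ x, shellSeq d r n x = shellMass d :=
  integral_shell_eq (shellSeq_left_pos hr n) (shellSeq_lt hr n) one_pos one_lt_two

theorem shellSeq_smul (hr : 0 < r) (n : ℕ) :
    (fun y => shellSeq d r n (0 + r • y))
      = (r ^ d)⁻¹ • shell d (radius (2 * n)) (radius (2 * n + 1)) := by
  ext y
  rw [shellSeq, zero_add, shell_scaling hr (strictMono_radius (2 * n).lt_succ_self),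
    inv_smul_smul₀ hr.ne', Pi.smul_apply, smul_eq_mul]

theorem disjoint_tsupport_shell {a' b' : ℝ} (hab : a < b) (hab' : a' < b') (h : b < a') :
    Disjoint (tsupport (shell d a b)) (tsupport (shell d a' b')) :=
  disjoint_left.2 fun _ hx hx' =>
    ((tsupport_shell_subset hab hx).2.trans_lt h).not_ge (tsupport_shell_subset hab' hx').1

theorem eventually_disjoint_shellSeq {s : ℝ} (hr : 0 < r) (hs : 0 < s) :
    ∀ᶠ n in atTop, Disjoint (tsupport (shellSeq d r n)) (tsupport (shellSeq d s (n + 1))) := by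
  have key : ∀ {p q : ℝ}, p < q → ∀ᶠ n in atTop, p < radius (2 * n) * q := fun {p q} hpq => by
    have := (tendsto_radius.comp tendsto_two_mul_atTop).mul_const q
    rw [one_mul] at this
    exact this.eventually_const_lt hpq
  rcases lt_trichotomy r s with h | rfl | h
  · have hsq : r ^ 2 < s ^ 2 := by gcongr
    filter_upwards [(tendsto_add_atTop_nat 1).eventually (key hsq)] with n hn
    exact disjoint_tsupport_shell (shellSeq_lt hr n) (shellSeq_lt hs (n + 1))
      ((shellSeq_right_lt hr n).trans hn)
  · refine Eventually.of_forall fun n => disjoint_tsupport_shell (shellSeq_lt hr n)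
      (shellSeq_lt hs (n + 1)) ?_
    have : radius (2 * n + 1) < radius (2 * (n + 1)) := strictMono_radius (by omega)
    gcongr
  · have hsq : s ^ 2 < r ^ 2 := by gcongr
    filter_upwards [key hsq] with n hn
    exact (disjoint_tsupport_shell (shellSeq_lt hs (n + 1)) (shellSeq_lt hr n)
      ((shellSeq_right_lt hs (n + 1)).trans hn)).symm

theorem tsupport_sum_smul_subset {ι : Type*} [Fintype ι] (c : ι → ℝ) (f : ι → Euc d → ℝ) :
    tsupport (∑ i, c i • f i) ⊆ ⋃ i, tsupport (f i) := by
  refine closure_minimal (fun x hx => ?_)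
    (isClosed_iUnion_of_finite fun i => isClosed_tsupport (f i))
  by_contra h
  refine hx ?_
  rw [Finset.sum_apply]
  refine Finset.sum_eq_zero fun i _ => ?_
  rw [Pi.smul_apply, image_eq_zero_of_notMem_tsupport fun hi => h (mem_iUnion.2 ⟨i, hi⟩), smul_zero]

end MeanValue

section Average

variable {d : ℕ} {Ω : Type} [MeasurableSpace Ω] (X : GFF d Ω) {r : ℝ}

namespace GFF

theorem h_shellSeq (hr : r ∈ Ioo (0 : ℝ) 1) (n : ℕ) :
    X.h 0 1 (shellSeq d r n)
      =ᵐ[X.P] X.H 0 r (shellSeq d r n) + shellMass d • X.sphAvg 0 r := by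
  have hsub : ball (0 : Euc d) r ⊆ ball 0 1 := ball_subset_ball hr.2.le
  have ht := isTestFun_shellSeq (d := d) hr.1 n
  filter_upwards [X.dmp_decomp 0 r hr.1 hsub _ ht, X.Φ_eq_integral hr.1 hsub] with ω h1 h2
  rw [h1, h2.2 _ ht (tsupport_shell_subset_ball hr.1 (shellSeq_lt hr.1 n)
    (shellSeq_right_lt hr.1 n))]
  have h3 := integral_harmonic_mul_shell hr.1 h2.1 (shellSeq_left_pos hr.1 n) (shellSeq_lt hr.1 n)
    (shellSeq_right_lt hr.1 n)
  have h4 := integral_shellSeq (d := d) hr.1 n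
  rw [← shellSeq, h4] at h3
  rw [h3, Pi.add_apply, Pi.smul_apply, smul_eq_mul, mul_comm (shellMass d), sphAvg]

theorem sphAvg_ae_eq (hd : 0 < d) (hr : r ∈ Ioo (0 : ℝ) 1) :
    X.sphAvg 0 r =ᵐ[X.P]
      (shellMass d)⁻¹ • (X.h 0 1 (shellSeq d r 0) - X.H 0 r (shellSeq d r 0)) := by
  filter_upwards [X.h_shellSeq hr 0] with ω hω
  simp [hω, (shellMass_pos hd).ne']

theorem memLp_sphAvg (hd : 0 < d) (hr : r ∈ Ioo (0 : ℝ) 1) : MemLp (X.sphAvg 0 r) 2 X.P :=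
  (((X.memLp_h (isTestFun_shellSeq hr.1 0)).sub (X.memLp_H hr.1 (ball_subset_ball hr.2.le)
    (isTestFun_shellSeq hr.1 0))).const_smul _).ae_eq (X.sphAvg_ae_eq hd hr).symm

theorem integral_sphAvg (hd : 0 < d) (hr : r ∈ Ioo (0 : ℝ) 1) :
    ∫ ω, X.sphAvg 0 r ω ∂X.P = 0 := by
  have ht := isTestFun_shellSeq (d := d) hr.1 0
  have hsub : ball (0 : Euc d) r ⊆ ball 0 1 := ball_subset_ball hr.2.le
  rw [integral_congr_ae (X.sphAvg_ae_eq hd hr)]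
  simp only [Pi.smul_apply, Pi.sub_apply, smul_eq_mul]
  rw [integral_const_mul, integral_sub (X.integrable_h 0 1 _ ht)
    ((X.memLp_H hr.1 hsub ht).integrable (by norm_num)), X.centered 0 1 _ ht,
    X.integral_H hr.1 hsub ht, sub_zero, mul_zero]

theorem tendsto_eLpNorm_H_shellSeq (hd : 0 < d) (hr : r ∈ Ioo (0 : ℝ) 1) :
    Tendsto (fun n => eLpNorm (X.H 0 r (shellSeq d r n)) 2 X.P) atTop (𝓝 0) := by
  have hsub : ball (0 : Euc d) r ⊆ ball 0 1 := ball_subset_ball hr.2.le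
  refine tendsto_eLpNorm_two_of_integral_sq
    (fun n => X.memLp_H hr.1 hsub (isTestFun_shellSeq hr.1 n)) ?_
  have hlt : ∀ n, radius (2 * n) < radius (2 * n + 1) := fun n =>
    strictMono_radius (2 * n).lt_succ_self
  have heq : ∀ n, ∫ ω, X.H 0 r (shellSeq d r n) ω ^ 2 ∂X.P
      = (r ^ (1 + (d : ℝ) / 2)) ^ 2 * (((r ^ d)⁻¹) ^ 2 *
        ∫ ω, X.h 0 1 (shell d (radius (2 * n)) (radius (2 * n + 1))) ω ^ 2 ∂X.P) := fun n => by
    rw [X.integral_H_sq hr.1 hsub (isTestFun_shellSeq hr.1 n), shellSeq_smul hr.1,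
      ← integral_const_mul (((r ^ d)⁻¹) ^ 2)]
    congr 1
    refine integral_congr_ae ?_
    filter_upwards [X.h_smul (isTestFun_shell (d := d) (radius_pos (2 * n)) (hlt n)) (r ^ d)⁻¹]
      with ω hω
    rw [hω, Pi.smul_apply, smul_eq_mul, mul_pow]
  simp only [heq]
  have := X.tendsto_integral_h_shell_sq hd (fun n => radius_pos (2 * n)) hlt
    (fun n => radius_lt_one _) (tendsto_radius.comp tendsto_two_mul_atTop)
  simpa only [mul_zero] using
    (this.const_mul (((r ^ d)⁻¹) ^ 2)).const_mul ((r ^ (1 + (d : ℝ) / 2)) ^ 2)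

variable {k : ℕ} {ρ : Fin k → ℝ}

theorem h_sum_shellSeq (hρ : ∀ i, ρ i ∈ Ioo (0 : ℝ) 1) (c : Fin k → ℝ) (n : ℕ) :
    X.h 0 1 (∑ i, c i • shellSeq d (ρ i) n) =ᵐ[X.P] ∑ i, c i • X.h 0 1 (shellSeq d (ρ i) n) := by
  refine (X.h_sum _ fun i _ => (isTestFun_shellSeq (hρ i).1 n).smul (c i)).trans ?_
  have h := fun i => X.h_smul (isTestFun_shellSeq (d := d) (hρ i).1 n) (c i)
  filter_upwards [ae_all_iff.2 h] with ω hω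
  rw [Finset.sum_apply, Finset.sum_apply]
  exact Finset.sum_congr rfl fun i _ => hω i

theorem tendsto_h_sum_shellSeq (hd : 0 < d) (hρ : ∀ i, ρ i ∈ Ioo (0 : ℝ) 1) (c : Fin k → ℝ) :
    Tendsto (fun n => eLpNorm (X.h 0 1 (∑ i, c i • shellSeq d (ρ i) n)
      - shellMass d • ∑ i, c i • X.sphAvg 0 (ρ i)) 2 X.P) atTop (𝓝 0) := by
  have heq : ∀ n, X.h 0 1 (∑ i, c i • shellSeq d (ρ i) n)
      - shellMass d • ∑ i, c i • X.sphAvg 0 (ρ i)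
        =ᵐ[X.P] ∑ i, c i • X.H 0 (ρ i) (shellSeq d (ρ i) n) := fun n => by
    filter_upwards [X.h_sum_shellSeq hρ c n, ae_all_iff.2 fun i => X.h_shellSeq (hρ i) n]
      with ω h1 h2
    simp only [Pi.sub_apply, h1, Finset.sum_apply, Pi.smul_apply, h2, Pi.add_apply, smul_eq_mul,
      Finset.mul_sum]
    rw [← Finset.sum_sub_distrib]
    exact Finset.sum_congr rfl fun i _ => by ring
  have hm := fun i n => X.memLp_H (hρ i).1 (ball_subset_ball (hρ i).2.le)
    (isTestFun_shellSeq (d := d) (hρ i).1 n)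
  have hlim : Tendsto (fun n => ∑ i, ‖c i‖ₑ * eLpNorm (X.H 0 (ρ i) (shellSeq d (ρ i) n)) 2 X.P)
      atTop (𝓝 (∑ i, ‖c i‖ₑ * 0)) := tendsto_finsetSum _ fun i _ =>
    ENNReal.Tendsto.const_mul (X.tendsto_eLpNorm_H_shellSeq hd (hρ i)) (Or.inr enorm_ne_top)
  simp only [mul_zero, Finset.sum_const_zero] at hlim
  refine tendsto_of_tendsto_of_tendsto_of_le_of_le tendsto_const_nhds hlim (fun n => zero_le)
    fun n => ?_
  simp only [eLpNorm_congr_ae (heq n)]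
  refine (eLpNorm_sum_le (fun i _ => ((hm i n).const_smul (c i)).aestronglyMeasurable)
    (by norm_num)).trans (Finset.sum_le_sum fun i _ => ?_)
  rw [eLpNorm_const_smul]

theorem charDefect_sum_sphAvg (hd : 0 < d) (hρ : ∀ i, ρ i ∈ Ioo (0 : ℝ) 1) (c : Fin k → ℝ) :
    charDefect X.P (shellMass d • ∑ i, c i • X.sphAvg 0 (ρ i))
      (shellMass d • ∑ i, c i • X.sphAvg 0 (ρ i))
      (shellMass d • ∑ i, c i • X.sphAvg 0 (ρ i)) = 0 := by
  set F : ℕ → Euc d → ℝ := fun n => ∑ i, c i • shellSeq d (ρ i) n with hF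
  have hS := fun i n => isTestFun_shellSeq (d := d) (hρ i).1 n
  have hFt : ∀ n, IsTestFun (F n) := fun n => IsTestFun.sum _ fun i _ => (hS i n).smul (c i)
  have hFm := fun n => X.memLp_h (hFt n)
  have hZ : MemLp (shellMass d • ∑ i, c i • X.sphAvg 0 (ρ i)) 2 X.P :=
    (memLp_finsetSum' _ fun i _ => (X.memLp_sphAvg hd (hρ i)).const_smul (c i)).const_smul _
  have hlim := X.tendsto_h_sum_shellSeq hd hρ c
  have ht := tendsto_charDefect hFm hZ hFm hZ (fun n => hFm (n + 1)) hZ hlim hlim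
    (hlim.comp (tendsto_add_atTop_nat 1))
  refine tendsto_nhds_unique ht (tendsto_const_nhds.congr' ?_)
  have hdisj : ∀ᶠ n in atTop, ∀ i j,
      Disjoint (tsupport (shellSeq d (ρ i) n)) (tsupport (shellSeq d (ρ j) (n + 1))) :=
    eventually_all.2 fun i => eventually_all.2 fun j =>
      eventually_disjoint_shellSeq (hρ i).1 (hρ j).1
  filter_upwards [hdisj] with n hn
  have hFd : Disjoint (tsupport (F n)) (tsupport (F (n + 1))) :=
    (disjoint_iUnion_left.2 fun i => disjoint_iUnion_right.2 fun j => hn i j).mono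
      (tsupport_sum_smul_subset _ _) (tsupport_sum_smul_subset _ _)
  rw [charDefect_congr (X.h_sum_shellSeq hρ c n) .rfl .rfl, charDefect_sum _
    (fun i _ => (X.integrable_h 0 1 _ (hS i n)).smul (c i)) (X.meas_h _ _ _).aemeasurable
    (X.meas_h _ _ _).aemeasurable]
  refine (Finset.sum_eq_zero fun i _ => ?_).symm
  rw [charDefect_smul, shellSeq, X.charDefect_shell hd (shellSeq_left_pos (hρ i).1 n)
    (shellSeq_lt (hρ i).1 n) ((shellSeq_right_lt (hρ i).1 n).trans
      (pow_lt_one₀ (hρ i).1.le (hρ i).2 two_ne_zero)) (hFt n) (hFt (n + 1)) hFd, mul_zero]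

end GFF

end Average

theorem isCenteredGaussianRV_of_charDefect {Ω : Type} [MeasurableSpace Ω] {P : Measure Ω}
    [IsProbabilityMeasure P] {Z : Ω → ℝ} (hZ : Measurable Z) (hZ2 : MemLp Z 2 P)
    (hZ0 : ∫ ω, Z ω ∂P = 0) (h : ∀ α : ℝ, charDefect P (α • Z) (α • Z) (α • Z) = 0) :
    IsCenteredGaussianRV P Z := by
  have e1 : ∀ α : ℝ, ∫ ω, (Z ω : ℂ) * Complex.exp (α * Z ω * Complex.I) ∂P
      = charInt P Z (α • Z) := fun α => by simp [charInt]
  have e2 : ∀ α : ℝ, ∫ ω, Complex.exp (α * Z ω * Complex.I) ∂P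
      = charInt P 1 (α • Z) := fun α => by simp [charInt]
  refine map_eq_gaussianReal_of_duplication hZ hZ2 hZ0 fun α => ?_
  rw [e1, e1, e2, e2]
  rcases eq_or_ne α 0 with rfl | hα
  · simp [charInt_zero_right, hZ0]
  · have hα' : (α : ℂ) ≠ 0 := by exact_mod_cast hα
    have := h α
    rw [charDefect, charInt_smul, charInt_smul, ← two_smul ℝ (α • Z), smul_smul] at this
    refine mul_left_cancel₀ hα' ?_
    linear_combination this

/-- the spherical average process `(h_r(0))_{r ∈ (0,1)}` is a Gaussian
process. -/
theorem statement14 (d : ℕ) (hd : 2 ≤ d) (Ω : Type) [MeasurableSpace Ω] (X : GFF d Ω) (k : ℕ) (r : Fin k → ℝ)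
    (hr : ∀ i, r i ∈ Set.Ioo (0 : ℝ) 1) (lam : Fin k → ℝ) :
    IsCenteredGaussianRV X.P (fun ω => ∑ i, lam i * X.sphAvg 0 (r i) ω) := by
  have hd0 : 0 < d := by omega
  have hmem : MemLp (fun ω => ∑ i, lam i * X.sphAvg 0 (r i) ω) 2 X.P :=
    memLp_finsetSum _ fun i _ => (X.memLp_sphAvg hd0 (hr i)).const_mul (lam i)
  refine isCenteredGaussianRV_of_charDefect
    (Finset.measurable_fun_sum _ fun i _ => (X.meas_φharm 0 (r i) 0).const_mul (lam i)) hmem ?_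
    fun α => ?_
  · rw [integral_finsetSum _ fun i _ =>
      ((X.memLp_sphAvg hd0 (hr i)).integrable (by norm_num)).const_mul (lam i)]
    refine Finset.sum_eq_zero fun i _ => ?_
    rw [integral_const_mul, X.integral_sphAvg hd0 (hr i), mul_zero]
  · have h := X.charDefect_sum_sphAvg hd0 hr fun i => α / shellMass d * lam i
    have e : shellMass d • ∑ i, (α / shellMass d * lam i) • X.sphAvg 0 (r i)
        = α • fun ω => ∑ i, lam i * X.sphAvg 0 (r i) ω := by
      have := (shellMass_pos hd0).ne'
      ext ω
      simp only [Pi.smul_apply, Finset.sum_apply, smul_eq_mul, Finset.mul_sum]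
      refine Finset.sum_congr rfl fun i _ => ?_
      field_simp
    rwa [e] at h
end
end

section
/- Let d ≥ 2, let φ be harmonic in the open unit ball 𝔹 ⊂ ℝ^d, let n ∈ ℕ₀, and let ψ : ∂𝔹 → ℝ be a smooth function such that the function z ↦ |z|ⁿ ψ(z/|z|) is harmonic in 𝔹. Then the function r ↦ r^{−n} ∫_{∂𝔹} ψ(θ) φ(rθ) ρ(dθ) is constant on (0, 1), where ρ denotes the uniform probability measure on ∂𝔹. -/
open MeasureTheory ProbabilityTheory Metric Filter Topology Set

noncomputable section

/-- The uniform probability measure on the sphere of radius `r` centered at the origin,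
as the normalized `(d-1)`-dimensional Hausdorff measure. -/
noncomputable def sphereUniform (d : ℕ) (r : ℝ) : Measure (Euc d) :=
  ((μH[((d : ℝ) - 1)] : Measure (Euc d)) (Metric.sphere (0 : Euc d) r))⁻¹ •
    (μH[((d : ℝ) - 1)] : Measure (Euc d)).restrict (Metric.sphere (0 : Euc d) r)


/-- A real function on an open set, packaged with its first two derivatives, of which the second
is continuous and trace-free. -/
structure HarmonicJet {d : ℕ} (U : Set (Euc d)) (f : Euc d → ℝ) (f' : Euc d → Euc d →L[ℝ] ℝ)
    (f'' : Euc d → Euc d →L[ℝ] Euc d →L[ℝ] ℝ) : Prop where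
  hasFDerivAt : ∀ x ∈ U, HasFDerivAt f (f' x) x
  hasFDerivAt' : ∀ x ∈ U, HasFDerivAt f' (f'' x) x
  continuousOn : ContinuousOn f'' U
  trace_eq_zero : ∀ x ∈ U,
    ∑ i : Fin d, f'' x (EuclideanSpace.single i 1) (EuclideanSpace.single i 1) = 0

namespace HarmonicJet

variable {d : ℕ} {U V : Set (Euc d)} {f : Euc d → ℝ} {f' : Euc d → Euc d →L[ℝ] ℝ}
  {f'' : Euc d → Euc d →L[ℝ] Euc d →L[ℝ] ℝ}

lemma continuousOn_zero (h : HarmonicJet U f f' f'') : ContinuousOn f U :=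
  fun x hx => (h.hasFDerivAt x hx).continuousAt.continuousWithinAt

lemma continuousOn_one (h : HarmonicJet U f f' f'') : ContinuousOn f' U :=
  fun x hx => (h.hasFDerivAt' x hx).continuousAt.continuousWithinAt

lemma mono (h : HarmonicJet U f f' f'') (hV : V ⊆ U) : HarmonicJet V f f' f'' where
  hasFDerivAt x hx := h.hasFDerivAt x (hV hx)
  hasFDerivAt' x hx := h.hasFDerivAt' x (hV hx)
  continuousOn := h.continuousOn.mono hV
  trace_eq_zero x hx := h.trace_eq_zero x (hV hx)

lemma comp_smul (h : HarmonicJet U f f' f'') (c : ℝ) (hV : ∀ x ∈ V, c • x ∈ U) :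
    HarmonicJet V (fun x => f (c • x)) (fun x => c • f' (c • x))
      (fun x => (c ^ 2) • f'' (c • x)) where
  hasFDerivAt x hx := by
    have h1 : HasFDerivAt (fun x : Euc d => c • x) (c • ContinuousLinearMap.id ℝ (Euc d)) x :=
      (hasFDerivAt_id x).const_smul c
    convert! (h.hasFDerivAt _ (hV x hx)).comp x h1 using 1
    ext v; simp
  hasFDerivAt' x hx := by
    have h1 : HasFDerivAt (fun x : Euc d => c • x) (c • ContinuousLinearMap.id ℝ (Euc d)) x :=
      (hasFDerivAt_id x).const_smul c
    convert! ((h.hasFDerivAt' _ (hV x hx)).comp x h1).const_smul c using 1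
    ext v w; simp; ring
  continuousOn := by
    exact (h.continuousOn.comp (continuous_const_smul c).continuousOn hV).const_smul (c ^ 2)
  trace_eq_zero x hx := by
    have := h.trace_eq_zero _ (hV x hx)
    simp [← Finset.mul_sum, this]

lemma hasDerivAt_ray (h : HarmonicJet U f f' f'') {θ : Euc d} {t : ℝ} (ht : t • θ ∈ U) :
    HasDerivAt (fun s : ℝ => f (s • θ)) (f' (t • θ) θ) t := by
  have h1 : HasDerivAt (fun s : ℝ => s • θ) θ t := by
    simpa using (hasDerivAt_id t).smul_const θ
  exact (h.hasFDerivAt _ ht).comp_hasDerivAt t h1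

lemma hasDerivAt_ray' (h : HarmonicJet U f f' f'') {θ : Euc d} {t : ℝ} (ht : t • θ ∈ U) :
    HasDerivAt (fun s : ℝ => f' (s • θ) θ) (f'' (t • θ) θ θ) t := by
  have h1 : HasDerivAt (fun s : ℝ => s • θ) θ t := by
    simpa using (hasDerivAt_id t).smul_const θ
  have h2 := (h.hasFDerivAt' _ ht).comp_hasDerivAt t h1
  simpa using h2.clm_apply (hasDerivAt_const t θ)

/-- Euler's identity for a function which is positively homogeneous of degree `n` along the ray
through `θ`, in the form in which it enters the spherical Laplacian. -/
lemma radial_of_homogeneous (h : HarmonicJet (ball 0 2) f f' f'') {θ : Euc d} (hθ : ‖θ‖ = 1)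
    (n : ℕ) (hn : ∀ t ∈ Ioo (0 : ℝ) 2, f (t • θ) = t ^ n * f θ) :
    f'' θ θ θ + ((d : ℝ) - 1) * f' θ θ = n * ((n : ℝ) + d - 2) * f θ := by
  have hU : ∀ t ∈ Ioo (0 : ℝ) 2, t • θ ∈ ball (0 : Euc d) 2 := fun t ht => by
    simpa [norm_smul, hθ, abs_of_pos ht.1] using ht.2
  have hI : ∀ t ∈ Ioo (0 : ℝ) 2, Ioo (0 : ℝ) 2 ∈ 𝓝 t := fun t ht => Ioo_mem_nhds ht.1 ht.2
  have h1 : ∀ t ∈ Ioo (0 : ℝ) 2, f' (t • θ) θ = n * t ^ (n - 1) * f θ := fun t ht => by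
    refine (h.hasDerivAt_ray (hU t ht)).unique ?_
    refine ((hasDerivAt_pow n t).mul_const (f θ)).congr_of_eventuallyEq ?_
    filter_upwards [hI t ht] with s hs using hn s hs
  have one_mem : (1 : ℝ) ∈ Ioo (0 : ℝ) 2 := by norm_num
  have h2 : f'' ((1 : ℝ) • θ) θ θ = n * (((n - 1 : ℕ) : ℝ) * 1 ^ (n - 1 - 1)) * f θ := by
    refine (h.hasDerivAt_ray' (hU 1 one_mem)).unique ?_
    refine (((hasDerivAt_pow (n - 1) (1 : ℝ)).const_mul (n : ℝ)).mul_const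
      (f θ)).congr_of_eventuallyEq ?_
    filter_upwards [hI 1 one_mem] with s hs using h1 s hs
  have h3 := h1 1 one_mem
  rw [one_smul] at h2 h3
  rw [h2, h3]
  rcases n with _ | n
  · simp
  · push_cast [Nat.add_sub_cancel]
    simp
    ring

end HarmonicJet

lemma IsHarmonicOn.harmonicJet {d : ℕ} {U : Set (Euc d)} (hU : IsOpen U) {f : Euc d → ℝ}
    (h : IsHarmonicOn f U) : HarmonicJet U f (fderiv ℝ f) (fderiv ℝ (fderiv ℝ f)) where
  hasFDerivAt x hx :=
    ((h.1.contDiffAt (hU.mem_nhds hx)).differentiableAt (by norm_num)).hasFDerivAt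
  hasFDerivAt' x hx :=
    (((h.1.contDiffAt (hU.mem_nhds hx)).fderiv_right (m := 1) (by norm_num)).differentiableAt
      (by norm_num)).hasFDerivAt
  continuousOn x hx := by
    have := (((h.1.contDiffAt (hU.mem_nhds hx)).fderiv_right (m := 1) (by norm_num)).fderiv_right
      (m := 0) (by norm_num))
    exact this.continuousAt.continuousWithinAt
  trace_eq_zero x hx := by
    have := h.2 x hx
    simpa [lap, iteratedFDeriv_two_apply] using this

section SphereIntegral

variable {d : ℕ} {σ : Measure (Euc d)}

lemma ae_mem_sphere (hσ : σ.restrict (sphere 0 1) = σ) : ∀ᵐ θ ∂σ, θ ∈ sphere (0 : Euc d) 1 := by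
  rw [← hσ]
  exact ae_restrict_mem isClosed_sphere.measurableSet

variable [IsFiniteMeasure σ]

lemma integrable_of_continuousOn_sphere (hσ : σ.restrict (sphere 0 1) = σ) {g : Euc d → ℝ}
    (hg : ContinuousOn g (sphere 0 1)) : Integrable g σ := by
  rw [← hσ]
  exact hg.integrableOn_compact (isCompact_sphere 0 1)

lemma hasDerivAt_integral_sphere (hσ : σ.restrict (sphere 0 1) = σ) {I : Set ℝ} (hI : IsOpen I)
    {K K' : ℝ → Euc d → ℝ} (hK : ∀ t ∈ I, ContinuousOn (K t) (sphere 0 1))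
    (hK' : ContinuousOn (fun p : ℝ × Euc d => K' p.1 p.2) (I ×ˢ sphere 0 1))
    (hd : ∀ t ∈ I, ∀ θ ∈ sphere (0 : Euc d) 1, HasDerivAt (fun s => K s θ) (K' t θ) t)
    {t : ℝ} (ht : t ∈ I) :
    HasDerivAt (fun s => ∫ θ, K s θ ∂σ) (∫ θ, K' t θ ∂σ) t := by
  obtain ⟨ε, hε, hball⟩ := Metric.nhds_basis_closedBall.mem_iff.1 (hI.mem_nhds ht)
  obtain ⟨C, hC⟩ := ((isCompact_closedBall t ε).prod
    (isCompact_sphere (0 : Euc d) 1)).exists_bound_of_continuousOn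
      (hK'.mono (prod_mono_left hball))
  have hK't : ContinuousOn (K' t) (sphere 0 1) :=
    hK'.comp (f := fun θ => (t, θ)) (by fun_prop) fun θ hθ => ⟨ht, hθ⟩
  refine (hasDerivAt_integral_of_dominated_loc_of_deriv_le (bound := fun _ => C)
    (closedBall_mem_nhds t hε) ?_ ?_ ?_ ?_ ?_ ?_).2
  · filter_upwards [hI.mem_nhds ht] with s hs
    exact (integrable_of_continuousOn_sphere hσ (hK s hs)).aestronglyMeasurable
  · exact integrable_of_continuousOn_sphere hσ (hK t ht)
  · exact (integrable_of_continuousOn_sphere hσ hK't).aestronglyMeasurable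
  · filter_upwards [ae_mem_sphere hσ] with θ hθ s hs
    exact hC (s, θ) ⟨hs, hθ⟩
  · exact integrable_const C
  · filter_upwards [ae_mem_sphere hσ] with θ hθ s hs
    exact hd s (hball hs) θ hθ

/-- Infinitesimal rotations are divergence-free for a rotation-invariant measure. -/
lemma integral_fderiv_skew_eq_zero (hσ : σ.restrict (sphere 0 1) = σ)
    (hinv : ∀ e : Euc d ≃ₗᵢ[ℝ] Euc d, MeasurePreserving e σ σ)
    {A : Euc d →L[ℝ] Euc d} (hA : A ∈ skewAdjoint (Euc d →L[ℝ] Euc d))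
    {g : Euc d → ℝ} {g' : Euc d → Euc d →L[ℝ] ℝ}
    (hg : ∀ x ∈ sphere (0 : Euc d) 1, HasFDerivAt g (g' x) x)
    (hg' : ContinuousOn g' (sphere 0 1)) : ∫ θ, g' θ (A θ) ∂σ = 0 := by
  let : NormedAlgebra ℚ (Euc d →L[ℝ] Euc d) := .restrictScalars ℚ ℝ _
  let R : ℝ → Euc d →L[ℝ] Euc d := fun t => NormedSpace.exp (t • A)
  have hR : ∀ t, R t ∈ unitary (Euc d →L[ℝ] Euc d) := fun t =>
    NormedSpace.exp_mem_unitary_of_mem_skewAdjoint (skewAdjoint.smul_mem t hA)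
  have hRd : ∀ t, HasDerivAt R (R t * A) t := fun t => hasDerivAt_exp_smul_const A t
  have hRc : Continuous R := continuous_iff_continuousAt.2 fun t => (hRd t).continuousAt
  have hRs : ∀ t, ∀ θ ∈ sphere (0 : Euc d) 1, R t θ ∈ sphere (0 : Euc d) 1 := fun t θ hθ => by
    rw [mem_sphere_zero_iff_norm] at hθ ⊢
    rw [ContinuousLinearMap.norm_map_of_mem_unitary (hR t), hθ]
  have hconst : ∀ t, ∫ θ, g (R t θ) ∂σ = ∫ θ, g θ ∂σ := fun t => by
    let e := Unitary.linearIsometryEquiv ⟨R t, hR t⟩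
    exact (hinv e).integral_comp e.toHomeomorph.measurableEmbedding g
  have hgc : ContinuousOn g (sphere 0 1) :=
    fun x hx => (hg x hx).continuousAt.continuousWithinAt
  have hderiv := hasDerivAt_integral_sphere (K := fun t θ => g (R t θ))
    (K' := fun t θ => g' (R t θ) (R t (A θ))) hσ isOpen_univ
    (fun t _ => hgc.comp (by fun_prop) (hRs t)) (by
      refine ContinuousOn.clm_apply (hg'.comp (Continuous.continuousOn ?_)
        fun p hp => hRs p.1 p.2 hp.2) (Continuous.continuousOn ?_)
      · exact (hRc.comp continuous_fst).clm_apply continuous_snd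
      · exact (hRc.comp continuous_fst).clm_apply (A.continuous.comp continuous_snd))
    (fun t _ θ hθ => by
      have h1 : HasDerivAt (fun s => R s θ) (R t (A θ)) t := by
        simpa using (hRd t).clm_apply (hasDerivAt_const t θ)
      exact (hg _ (hRs t θ hθ)).comp_hasDerivAt t h1) (mem_univ 0)
  simp only [hconst] at hderiv
  have := hderiv.unique (hasDerivAt_const (0 : ℝ) (∫ θ, g θ ∂σ))
  have hR0 : R 0 = 1 := by simp only [R, zero_smul ℝ A, NormedSpace.exp_zero]
  simpa [hR0] using this

/-- Symmetry of the square of an infinitesimal rotation. -/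
lemma integral_skew_sq_symm (hσ : σ.restrict (sphere 0 1) = σ)
    (hinv : ∀ e : Euc d ≃ₗᵢ[ℝ] Euc d, MeasurePreserving e σ σ)
    {A : Euc d →L[ℝ] Euc d} (hA : A ∈ skewAdjoint (Euc d →L[ℝ] Euc d))
    {U : Set (Euc d)} (hU : sphere 0 1 ⊆ U)
    {f h : Euc d → ℝ} {f' h' : Euc d → Euc d →L[ℝ] ℝ}
    {f'' h'' : Euc d → Euc d →L[ℝ] Euc d →L[ℝ] ℝ}
    (hf : HarmonicJet U f f' f'') (hh : HarmonicJet U h h' h'') :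
    ∫ θ, (f θ * (h'' θ (A θ) (A θ) + h' θ (A (A θ)))
      - h θ * (f'' θ (A θ) (A θ) + f' θ (A (A θ)))) ∂σ = 0 := by
  have key : ∀ {f : Euc d → ℝ} {f' : Euc d → Euc d →L[ℝ] ℝ}
    {f'' : Euc d → Euc d →L[ℝ] Euc d →L[ℝ] ℝ}, HarmonicJet U f f' f'' → ∀ x ∈ sphere 0 1,
      HasFDerivAt (fun x => f' x (A x)) ((f' x).comp A + (f'' x).flip (A x)) x :=
    fun hf x hx => (hf.hasFDerivAt' x (hU hx)).clm_apply A.hasFDerivAt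
  have key2 : ∀ {f : Euc d → ℝ} {f' : Euc d → Euc d →L[ℝ] ℝ}
    {f'' : Euc d → Euc d →L[ℝ] Euc d →L[ℝ] ℝ}, HarmonicJet U f f' f'' →
      ContinuousOn (fun x => (f' x).comp A + (f'' x).flip (A x)) (sphere 0 1) := by
    intro f f' f'' hf
    have h1 := hf.continuousOn_one.mono hU
    have h2 := hf.continuousOn.mono hU
    refine (h1.clm_comp continuousOn_const).add ?_
    refine ContinuousOn.clm_apply ?_ A.continuous.continuousOn
    exact (ContinuousLinearMap.flipₗᵢ ℝ (Euc d) (Euc d) ℝ).continuous.comp_continuousOn h2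
  have := integral_fderiv_skew_eq_zero hσ hinv hA
    (g := fun x => f x * h' x (A x) - h x * f' x (A x))
    (fun x hx => (((hf.hasFDerivAt x (hU hx)).mul (key hh x hx)).sub
      ((hh.hasFDerivAt x (hU hx)).mul (key hf x hx)))) (by
      have a1 := key2 hf
      have a2 := key2 hh
      have b1 := hf.continuousOn_zero.mono hU
      have b2 := hh.continuousOn_zero.mono hU
      have c1 := hf.continuousOn_one.mono hU
      have c2 := hh.continuousOn_one.mono hU
      have d1 := c1.clm_apply A.continuous.continuousOn
      have d2 := c2.clm_apply A.continuous.continuousOn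
      exact ((b1.smul a2).add (d2.smul c1)).sub ((b2.smul a1).add (d1.smul c2)))
  rw [← this]
  congr 1 with θ
  simp
  ring

/-- The infinitesimal rotation in the plane spanned by the `i`-th and `j`-th basis vectors. -/
def planeRotation (d : ℕ) (i j : Fin d) : Euc d →L[ℝ] Euc d :=
  (EuclideanSpace.proj i : Euc d →L[ℝ] ℝ).smulRight (EuclideanSpace.single j 1)
    - (EuclideanSpace.proj j : Euc d →L[ℝ] ℝ).smulRight (EuclideanSpace.single i 1)

lemma planeRotation_apply (i j : Fin d) (x : Euc d) : planeRotation d i j x =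
    x i • EuclideanSpace.single j 1 - x j • EuclideanSpace.single i 1 := rfl

lemma planeRotation_mem_skewAdjoint (i j : Fin d) :
    planeRotation d i j ∈ skewAdjoint (Euc d →L[ℝ] Euc d) := by
  rw [skewAdjoint.mem_iff, ContinuousLinearMap.star_eq_adjoint, eq_comm,
    ContinuousLinearMap.eq_adjoint_iff]
  intro x y
  simp [planeRotation_apply, inner_sub_left, inner_sub_right, inner_smul_left, inner_smul_right,
    EuclideanSpace.inner_single_left, EuclideanSpace.inner_single_right]
  ring

lemma euc_eq_sum (x : Euc d) : x = ∑ i, x i • EuclideanSpace.single i (1 : ℝ) := by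
  simpa using ((EuclideanSpace.basisFun (Fin d) ℝ).sum_repr x).symm

lemma sum_planeRotation (B : Euc d →L[ℝ] Euc d →L[ℝ] ℝ) (L : Euc d →L[ℝ] ℝ) (x : Euc d) :
    ∑ i, ∑ j, (B (planeRotation d i j x) (planeRotation d i j x)
        + L (planeRotation d i j (planeRotation d i j x)))
      = 2 * (‖x‖ ^ 2 * ∑ i, B (EuclideanSpace.single i 1) (EuclideanSpace.single i 1)
          - (B x x + ((d : ℝ) - 1) * L x)) := by
  have hB : B x x = ∑ i, ∑ j, x i * x j *
      B (EuclideanSpace.single i 1) (EuclideanSpace.single j 1) := by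
    conv_lhs => rw [euc_eq_sum x]
    simp only [map_sum, map_smul, _root_.sum_apply, _root_.smul_apply,
      smul_eq_mul, Finset.mul_sum]
    rw [Finset.sum_comm]
    exact Finset.sum_congr rfl fun i _ => Finset.sum_congr rfl fun j _ => by ring
  have hL : L x = ∑ i, x i * L (EuclideanSpace.single i 1) := by
    conv_lhs => rw [euc_eq_sum x]
    simp
  have hx : ‖x‖ ^ 2 = ∑ i, x i ^ 2 := EuclideanSpace.real_norm_sq_eq x
  have e1 : ∀ i j, B (planeRotation d i j x) (planeRotation d i j x) =
      x i ^ 2 * B (EuclideanSpace.single j 1) (EuclideanSpace.single j 1)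
      + x j ^ 2 * B (EuclideanSpace.single i 1) (EuclideanSpace.single i 1)
      - x i * x j * B (EuclideanSpace.single i 1) (EuclideanSpace.single j 1)
      - x j * x i * B (EuclideanSpace.single j 1) (EuclideanSpace.single i 1) := by
    intro i j
    simp [planeRotation_apply]
    ring
  have e2 : ∀ i j, L (planeRotation d i j (planeRotation d i j x)) =
      (if i = j then x i * L (EuclideanSpace.single j 1) else 0)
      + (if i = j then x j * L (EuclideanSpace.single i 1) else 0)
      - x i * L (EuclideanSpace.single i 1) - x j * L (EuclideanSpace.single j 1) := by
    intro i j
    rcases eq_or_ne i j with rfl | hij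
    · simp [planeRotation_apply]
    · simp [planeRotation_apply, hij, hij.symm]
      ring
  simp only [e1, e2, Finset.sum_add_distrib, Finset.sum_sub_distrib]
  rw [Finset.sum_comm (f := fun i j => x j * x i *
      B (EuclideanSpace.single j 1) (EuclideanSpace.single i 1)), ← hB]
  simp only [← Finset.mul_sum, ← Finset.sum_mul, Finset.sum_const, Finset.card_univ,
    Fintype.card_fin, nsmul_eq_mul, Finset.sum_ite_eq, Finset.mem_univ, if_true, ← hL, ← hx]
  have hLd : ∑ i, x i * (d * L (EuclideanSpace.single i 1)) = d * L x := by
    rw [hL, Finset.mul_sum]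
    exact Finset.sum_congr rfl fun i _ => by ring
  rw [hLd]
  ring

/-- Green's second identity on the unit sphere, for restrictions of harmonic functions: the
spherical Laplacian is symmetric, and on harmonic functions it is a radial operator. -/
lemma integral_radial_symm (hσ : σ.restrict (sphere 0 1) = σ)
    (hinv : ∀ e : Euc d ≃ₗᵢ[ℝ] Euc d, MeasurePreserving e σ σ)
    {U : Set (Euc d)} (hU : sphere 0 1 ⊆ U)
    {f h : Euc d → ℝ} {f' h' : Euc d → Euc d →L[ℝ] ℝ}
    {f'' h'' : Euc d → Euc d →L[ℝ] Euc d →L[ℝ] ℝ}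
    (hf : HarmonicJet U f f' f'') (hh : HarmonicJet U h h' h'') :
    ∫ θ, (f θ * (h'' θ θ θ + ((d : ℝ) - 1) * h' θ θ)
      - h θ * (f'' θ θ θ + ((d : ℝ) - 1) * f' θ θ)) ∂σ = 0 := by
  have h1 := fun i j => integral_skew_sq_symm hσ hinv (planeRotation_mem_skewAdjoint i j) hU hf hh
  have h2 : ∑ i, ∑ j, ∫ θ, (f θ * (h'' θ (planeRotation d i j θ) (planeRotation d i j θ)
      + h' θ (planeRotation d i j (planeRotation d i j θ)))
      - h θ * (f'' θ (planeRotation d i j θ) (planeRotation d i j θ)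
      + f' θ (planeRotation d i j (planeRotation d i j θ)))) ∂σ = 0 := by
    simp only [h1, Finset.sum_const_zero]
  have hint : ∀ i j, Integrable (fun θ =>
      (f θ * (h'' θ (planeRotation d i j θ) (planeRotation d i j θ)
      + h' θ (planeRotation d i j (planeRotation d i j θ)))
      - h θ * (f'' θ (planeRotation d i j θ) (planeRotation d i j θ)
      + f' θ (planeRotation d i j (planeRotation d i j θ))))) σ := fun i j => by
    have b1 := hf.continuousOn_zero.mono hU
    have b2 := hh.continuousOn_zero.mono hU
    have c1 := hf.continuousOn_one.mono hU
    have c2 := hh.continuousOn_one.mono hU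
    have d1 := hf.continuousOn.mono hU
    have d2 := hh.continuousOn.mono hU
    have hA : ContinuousOn (planeRotation d i j) (sphere 0 1) :=
      (planeRotation d i j).continuous.continuousOn
    have hA2 : ContinuousOn (fun x => planeRotation d i j (planeRotation d i j x)) (sphere 0 1) :=
      (planeRotation d i j).continuous.comp_continuousOn hA
    exact integrable_of_continuousOn_sphere hσ
      ((b1.mul (((d2.clm_apply hA).clm_apply hA).add (c2.clm_apply hA2))).sub
        (b2.mul (((d1.clm_apply hA).clm_apply hA).add (c1.clm_apply hA2))))
  simp only [← integral_finsetSum _ fun j _ => hint _ j] at h2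
  rw [← integral_finsetSum _ fun i _ => integrable_finsetSum _ fun j _ => hint i j] at h2
  have h3 : ∀ᵐ θ ∂σ, ∑ i, ∑ j, (f θ * (h'' θ (planeRotation d i j θ) (planeRotation d i j θ)
      + h' θ (planeRotation d i j (planeRotation d i j θ)))
      - h θ * (f'' θ (planeRotation d i j θ) (planeRotation d i j θ)
      + f' θ (planeRotation d i j (planeRotation d i j θ)))) =
      (-2) * (f θ * (h'' θ θ θ + ((d : ℝ) - 1) * h' θ θ)
      - h θ * (f'' θ θ θ + ((d : ℝ) - 1) * f' θ θ)) := by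
    filter_upwards [ae_mem_sphere hσ] with θ hθ
    simp only [Finset.sum_sub_distrib, ← Finset.mul_sum, sum_planeRotation,
      hf.trace_eq_zero θ (hU hθ), hh.trace_eq_zero θ (hU hθ)]
    ring
  rw [integral_congr_ae h3, integral_const_mul] at h2
  linarith

end SphereIntegral

lemma eq_of_hasDerivAt_zero {f : ℝ → ℝ} {a b : ℝ} (hab : a < b) (hc : ContinuousOn f (Icc a b))
    (hf : ∀ x ∈ Ioo a b, HasDerivAt f 0 x) : f a = f b := by
  obtain ⟨c, -, h⟩ := exists_hasDerivAt_eq_slope f (fun _ => 0) hab hc hf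
  have := sub_pos.2 hab
  rw [eq_comm, div_eq_zero_iff] at h
  rcases h with h | h <;> linarith

/-- Solutions of the radial Laplace equation of degree `n` which are regular at the origin are
multiples of `r ^ n`. -/
lemma radial_ode {d n : ℕ} (hd : 2 ≤ d) {G G' G'' : ℝ → ℝ}
    (hG : ∀ r ∈ Ioo (-1 : ℝ) 1, HasDerivAt G (G' r) r)
    (hG' : ∀ r ∈ Ioo (-1 : ℝ) 1, HasDerivAt G' (G'' r) r)
    (hode : ∀ r ∈ Ioo (0 : ℝ) 1,
      r ^ 2 * G'' r + ((d : ℝ) - 1) * (r * G' r) = n * ((n : ℝ) + d - 2) * G r)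
    {a b : ℝ} (ha : a ∈ Ioo (0 : ℝ) 1) (hb : b ∈ Ioo (0 : ℝ) 1) :
    (a ^ n)⁻¹ * G a = (b ^ n)⁻¹ * G b := by
  obtain ⟨m, hm⟩ : ∃ m : ℕ, n + d = m + 2 := ⟨n + d - 2, by omega⟩
  have hmR : (n : ℝ) + d = m + 2 := by exact_mod_cast hm
  have hsub : ∀ r ∈ Ico (0 : ℝ) 1, r ∈ Ioo (-1 : ℝ) 1 := fun r hr => ⟨by linarith [hr.1], hr.2⟩
  have hP : ∀ r ∈ Ioo (-1 : ℝ) 1, HasDerivAt (fun r => r ^ m * (r * G' r - n * G r))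
      (m * r ^ (m - 1) * (r * G' r - n * G r) + r ^ m * (1 * G' r + r * G'' r - n * G' r)) r :=
    fun r hr => (hasDerivAt_pow m r).mul
      (((hasDerivAt_id r).mul (hG' r hr)).sub ((hG r hr).const_mul (n : ℝ)))
  have hfirst : ∀ r ∈ Ioo (0 : ℝ) 1, r * G' r = n * G r := fun r hr => by
    have h0 : (0 : ℝ) ^ m * (0 * G' 0 - n * G 0) = r ^ m * (r * G' r - n * G r) := by
      refine eq_of_hasDerivAt_zero (f := fun r => r ^ m * (r * G' r - n * G r)) hr.1
        (fun s hs => (hP s (hsub s ⟨hs.1, hs.2.trans_lt hr.2⟩)).continuousAt.continuousWithinAt)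
        fun s hs => ?_
      have hs' : s ∈ Ioo (0 : ℝ) 1 := ⟨hs.1, hs.2.trans hr.2⟩
      convert hP s (hsub s ⟨hs'.1.le, hs'.2⟩) using 1
      have hpow : (m : ℝ) * s ^ (m - 1) * s = m * s ^ m := by
        rcases m with _ | m
        · simp
        · rw [Nat.add_sub_cancel, pow_succ]; ring
      refine (mul_right_cancel₀ hs'.1.ne' ?_).symm
      have hd' : (d : ℝ) = m + 2 - n := by linarith
      have hode' := hode s hs'
      rw [hd'] at hode'
      linear_combination (s * G' s - n * G s) * hpow + s ^ m * hode'
    have hz : (0 : ℝ) ^ m * (0 * G' 0 - n * G 0) = 0 := by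
      rcases m with _ | m
      · obtain rfl : n = 0 := by omega
        simp
      · simp
    rw [hz, eq_comm, mul_eq_zero] at h0
    have := h0.resolve_left (pow_pos hr.1 m).ne'
    linarith
  have hQ : ∀ r ∈ Ioo (0 : ℝ) 1, HasDerivAt (fun r => (r ^ n)⁻¹ * G r) 0 r := fun r hr => by
    have hr0 := hr.1.ne'
    convert! ((hasDerivAt_pow n r).inv (pow_ne_zero n hr0)).mul
      (hG r (hsub r ⟨hr.1.le, hr.2⟩)) using 1
    have hpow : (n : ℝ) * r ^ (n - 1) * r = n * r ^ n := by
      rcases n with _ | n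
      · simp
      · rw [Nat.add_sub_cancel, pow_succ]; ring
    simp only [Pi.inv_apply]
    field_simp
    refine mul_right_cancel₀ hr0 ?_
    linear_combination G r * hpow - r ^ n * hfirst r hr
  have hlt : ∀ a ∈ Ioo (0 : ℝ) 1, ∀ b ∈ Ioo (0 : ℝ) 1, a < b →
      (a ^ n)⁻¹ * G a = (b ^ n)⁻¹ * G b := fun a ha b hb hab =>
    eq_of_hasDerivAt_zero (f := fun r => (r ^ n)⁻¹ * G r) hab
      (fun s hs => (hQ s ⟨ha.1.trans_le hs.1, hs.2.trans_lt hb.2⟩).continuousAt.continuousWithinAt)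
      fun s hs => hQ s ⟨ha.1.trans hs.1, hs.2.trans hb.2⟩
  rcases lt_trichotomy a b with h | rfl | h
  · exact hlt a ha b hb h
  · rfl
  · exact (hlt b hb a ha h).symm

section SphereUniform

variable (d : ℕ)

instance isFiniteMeasure_sphereUniform : IsFiniteMeasure (sphereUniform d 1) := by
  refine ⟨?_⟩
  rw [sphereUniform, Measure.smul_apply, Measure.restrict_apply_univ, smul_eq_mul]
  exact ENNReal.inv_mul_le_one _ |>.trans_lt ENNReal.one_lt_top

lemma sphereUniform_restrict : (sphereUniform d 1).restrict (sphere 0 1) = sphereUniform d 1 := by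
  rw [sphereUniform, Measure.restrict_smul, Measure.restrict_restrict
    isClosed_sphere.measurableSet, inter_self]

lemma measurePreserving_sphereUniform (e : Euc d ≃ₗᵢ[ℝ] Euc d) :
    MeasurePreserving e (sphereUniform d 1) (sphereUniform d 1) := by
  have h := (e.toIsometryEquiv.measurePreserving_hausdorffMeasure ((d : ℝ) - 1)).restrict_preimage
    (isClosed_sphere (x := (0 : Euc d)) (ε := 1)).measurableSet
  have hpre : e.toIsometryEquiv ⁻¹' sphere (0 : Euc d) 1 = sphere 0 1 := by
    ext x; simp
  rw [hpre] at h
  exact h.smul_measure _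

end SphereUniform

/-- if `φ` is harmonic in `𝔹` and `z ↦ |z|ⁿ ψ(z/|z|)` is harmonic in `𝔹`, then
`r ↦ r^{-n} ∫_{∂𝔹} ψ(θ) φ(rθ) ρ(dθ)` is constant on `(0,1)`. -/
theorem statement16 (d : ℕ) (hd : 2 ≤ d) (φ : Euc d → ℝ)
    (hφ : IsHarmonicOn φ (ball (0 : Euc d) 1)) (n : ℕ) (ψ : Euc d → ℝ)
    (hψ : ContDiffOn ℝ (⊤ : ℕ∞) ψ (Metric.sphere (0 : Euc d) 1))
    (hharm : ∃ u : Euc d → ℝ, IsHarmonicOn u (ball (0 : Euc d) 1) ∧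
      ∀ z : Euc d, z ≠ 0 → ‖z‖ < 1 → u z = ‖z‖ ^ n * ψ (‖z‖⁻¹ • z)) :
    ∀ r₁ ∈ Set.Ioo (0 : ℝ) 1, ∀ r₂ ∈ Set.Ioo (0 : ℝ) 1,
      (r₁ ^ n)⁻¹ * ∫ θ, ψ θ * φ (r₁ • θ) ∂(sphereUniform d 1)
        = (r₂ ^ n)⁻¹ * ∫ θ, ψ θ * φ (r₂ • θ) ∂(sphereUniform d 1) := by
  obtain ⟨u, hu, huψ⟩ := hharm
  set σ := sphereUniform d 1
  have hσ : σ.restrict (sphere 0 1) = σ := sphereUniform_restrict d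
  have hφj := hφ.harmonicJet isOpen_ball
  set φ' := fderiv ℝ φ
  set φ'' := fderiv ℝ φ'
  have hwj := (hu.harmonicJet isOpen_ball).comp_smul (V := ball (0 : Euc d) 2) (1 / 2)
    fun x hx => by
      rw [mem_ball_zero_iff] at hx ⊢
      rw [norm_smul]
      norm_num
      linarith
  set w : Euc d → ℝ := fun x => u ((1 / 2 : ℝ) • x) with hw
  have hS2 : sphere (0 : Euc d) 1 ⊆ ball 0 2 := sphere_subset_ball (by norm_num)
  have hwray : ∀ θ ∈ sphere (0 : Euc d) 1, ∀ t ∈ Ioo (0 : ℝ) 2,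
      w (t • θ) = (t / 2) ^ n * ψ θ := fun θ hθ t ht => by
    rw [mem_sphere_zero_iff_norm] at hθ
    have ht2 : 0 < t / 2 := half_pos ht.1
    have hnorm : ‖(t / 2) • θ‖ = t / 2 := by rw [norm_smul, hθ, mul_one, Real.norm_of_nonneg ht2.le]
    have hne : (t / 2) • θ ≠ 0 := by
      rw [← norm_ne_zero_iff, hnorm]; exact ht2.ne'
    have := huψ ((t / 2) • θ) hne (by rw [hnorm]; linarith [ht.2])
    rw [hnorm, smul_smul, inv_mul_cancel₀ ht2.ne', one_smul] at this
    rw [← this, hw]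
    simp only [smul_smul]
    congr 2
    ring
  have hwψ : ∀ θ ∈ sphere (0 : Euc d) 1, w θ = (1 / 2) ^ n * ψ θ := fun θ hθ => by
    simpa using hwray θ hθ 1 (by norm_num)
  have hwc : ContinuousOn w (sphere 0 1) := hwj.continuousOn_zero.mono hS2
  have hmem : ∀ r ∈ Ioo (-1 : ℝ) 1, ∀ θ ∈ sphere (0 : Euc d) 1, r • θ ∈ ball (0 : Euc d) 1 :=
    fun r hr θ hθ => by
      rw [mem_sphere_zero_iff_norm] at hθ
      rw [mem_ball_zero_iff, norm_smul, hθ, mul_one]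
      exact abs_lt.2 hr
  have hmaps : MapsTo (fun p : ℝ × Euc d => p.1 • p.2) (Ioo (-1 : ℝ) 1 ×ˢ sphere 0 1)
      (ball 0 1) := fun p hp => hmem p.1 hp.1 p.2 hp.2
  have hsmul : ContinuousOn (fun p : ℝ × Euc d => p.1 • p.2) (Ioo (-1 : ℝ) 1 ×ˢ sphere 0 1) := by
    fun_prop
  have hwc2 : ContinuousOn (fun p : ℝ × Euc d => w p.2) (Ioo (-1 : ℝ) 1 ×ˢ sphere 0 1) :=
    hwc.comp continuousOn_snd fun p hp => hp.2
  have c0 : ∀ r ∈ Ioo (-1 : ℝ) 1, ContinuousOn (fun θ => φ (r • θ)) (sphere 0 1) := fun r hr =>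
    hφj.continuousOn_zero.comp (by fun_prop) (hmem r hr)
  have c1 := hφj.continuousOn_one.comp hsmul hmaps
  have c2 := hφj.continuousOn.comp hsmul hmaps
  have c1' : ∀ r ∈ Ioo (-1 : ℝ) 1, ContinuousOn (fun θ => φ' (r • θ)) (sphere 0 1) := fun r hr =>
    hφj.continuousOn_one.comp (by fun_prop) (hmem r hr)
  have c2' : ∀ r ∈ Ioo (-1 : ℝ) 1, ContinuousOn (fun θ => φ'' (r • θ)) (sphere 0 1) := fun r hr =>
    hφj.continuousOn.comp (by fun_prop) (hmem r hr)
  have hG : ∀ r ∈ Ioo (-1 : ℝ) 1, HasDerivAt (fun r => ∫ θ, w θ * φ (r • θ) ∂σ)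
      (∫ θ, w θ * φ' (r • θ) θ ∂σ) r := fun r hr =>
    hasDerivAt_integral_sphere (K := fun r θ => w θ * φ (r • θ))
      (K' := fun r θ => w θ * φ' (r • θ) θ) hσ isOpen_Ioo (fun t ht => hwc.mul (c0 t ht))
      (hwc2.mul (c1.clm_apply continuousOn_snd))
      (fun t ht θ hθ => (hφj.hasDerivAt_ray (hmem t ht θ hθ)).const_mul _) hr
  have hG' : ∀ r ∈ Ioo (-1 : ℝ) 1, HasDerivAt (fun r => ∫ θ, w θ * φ' (r • θ) θ ∂σ)
      (∫ θ, w θ * φ'' (r • θ) θ θ ∂σ) r := fun r hr =>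
    hasDerivAt_integral_sphere (K := fun r θ => w θ * φ' (r • θ) θ)
      (K' := fun r θ => w θ * φ'' (r • θ) θ θ) hσ isOpen_Ioo
      (fun t ht => hwc.mul ((c1' t ht).clm_apply continuousOn_id))
      (hwc2.mul ((c2.clm_apply continuousOn_snd).clm_apply continuousOn_snd))
      (fun t ht θ hθ => (hφj.hasDerivAt_ray' (hmem t ht θ hθ)).const_mul _) hr
  have hode : ∀ r ∈ Ioo (0 : ℝ) 1, r ^ 2 * (∫ θ, w θ * φ'' (r • θ) θ θ ∂σ)
      + ((d : ℝ) - 1) * (r * ∫ θ, w θ * φ' (r • θ) θ ∂σ)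
      = n * ((n : ℝ) + d - 2) * ∫ θ, w θ * φ (r • θ) ∂σ := fun r hr => by
    have hr' : r ∈ Ioo (-1 : ℝ) 1 := ⟨by linarith [hr.1], hr.2⟩
    have hgreen := integral_radial_symm (U := ball 0 2 ∩ (r • ·) ⁻¹' ball 0 1) hσ
      (measurePreserving_sphereUniform d)
      (fun θ hθ => ⟨hS2 hθ, hmem r hr' θ hθ⟩)
      (hwj.mono inter_subset_left)
      (hφj.comp_smul r fun x hx => hx.2)
    have hae : ∀ᵐ θ ∂σ, _ = (r ^ 2 * (w θ * φ'' (r • θ) θ θ)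
        + ((d : ℝ) - 1) * (r * (w θ * φ' (r • θ) θ)))
        - n * ((n : ℝ) + d - 2) * (w θ * φ (r • θ)) :=
      (ae_mem_sphere hσ).mono fun θ hθ => by
        have hrad := hwj.radial_of_homogeneous (mem_sphere_zero_iff_norm.1 hθ) n
          fun t ht => by rw [hwray θ hθ t ht, hwψ θ hθ]; ring
        refine Eq.trans (congrArg (fun z => w θ * ((r ^ 2 • φ'' (r • θ)) θ θ
          + ((d : ℝ) - 1) * (r • φ' (r • θ)) θ) - φ (r • θ) * z) hrad) ?_
        simp
        ring
    rw [integral_congr_ae hae] at hgreen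
    have i0 : Integrable (fun θ => w θ * φ (r • θ)) σ :=
      integrable_of_continuousOn_sphere hσ (hwc.mul (c0 r hr'))
    have i1 : Integrable (fun θ => w θ * φ' (r • θ) θ) σ := integrable_of_continuousOn_sphere hσ
      (hwc.mul ((c1' r hr').clm_apply continuousOn_id))
    have i2 : Integrable (fun θ => w θ * φ'' (r • θ) θ θ) σ := integrable_of_continuousOn_sphere hσ
      (hwc.mul (((c2' r hr').clm_apply continuousOn_id).clm_apply continuousOn_id))
    have i12 : Integrable (fun θ => r ^ 2 * (w θ * φ'' (r • θ) θ θ)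
        + ((d : ℝ) - 1) * (r * (w θ * φ' (r • θ) θ))) σ :=
      (i2.const_mul _).add ((i1.const_mul _).const_mul _)
    rw [integral_sub i12 (i0.const_mul _),
      integral_add (i2.const_mul _) ((i1.const_mul _).const_mul _)] at hgreen
    simp only [integral_const_mul] at hgreen
    linarith
  have hψw : ∀ r : ℝ, ∫ θ, w θ * φ (r • θ) ∂σ = (1 / 2) ^ n * ∫ θ, ψ θ * φ (r • θ) ∂σ :=
    fun r => by
      rw [← integral_const_mul]
      refine integral_congr_ae ((ae_mem_sphere hσ).mono fun θ hθ => ?_)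
      simp only [hwψ θ hθ]
      ring
  intro r₁ hr₁ r₂ hr₂
  have hfinal := radial_ode hd hG hG' hode hr₁ hr₂
  simp only [hψw] at hfinal
  refine mul_left_cancel₀ (pow_ne_zero n (by norm_num : (1 / 2 : ℝ) ≠ 0)) ?_
  linear_combination hfinal
end
end
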